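/- arXiv:2304.07088 — 2 statements merged into one kernel-verified Lean document; each statement's English description precedes it below -/
import Mathlib

section
/- Let a be as in the degeneracy context, let C_HP > 0 satisfy the weighted Hardy inequality, let β ≥ 0, γ ≥ 0, and let y be a smooth classical solution of the degenerate beam problem on [0,T]×[0,1] with energy E(t). Set C_β := min{2,2/β} if β > 0, C_β := 2 if β = 0; C_γ := min{2,2/γ} if γ > 0, C_γ := 2 if γ = 0; ν := βγ/(2(β+γ)) if β > 1 and γ > 1, ν := γ/(2(1+γ)) if β ∈ [0,1] and γ > 1, ν := β/(2(β+1)) if β > 1 and γ ∈ [0,1], ν := 1/4 if β ∈ [0,1] and γ ∈ [0,1]; and for δ > 0 set C_δ := 1 − 2δ(1/β + 1/γ) if β > 1 and γ > 1, C_δ := 1 − 2δ(1 + 1/γ) if β ∈ [0,1] and γ > 1, C_δ := 1 − 2δ(1/β + 1) if β > 1 and γ ∈ [0,1], C_δ := 1 − 4δ if β ∈ [0,1] and γ ∈ [0,1]. Then for every 0 < s < T and every δ ∈ (0, ν): ∫ₛ^T y(t,1)² dt + ∫ₛ^T (∂_x y(t,1))² dt ≤ (2δ/C_δ)∫ₛ^T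 E(t) dt + (1/C_δ)·(2(1 + (4C_HP+1)(C_β + C_γ)) + (1/δ)(8C_HP + 3))·E(s). -/
open MeasureTheory intervalIntegral

/-- A function continuous on a closed rectangle agrees there with a continuous function. -/
lemma exists_continuous_eq_on_rectangle {f : ℝ → ℝ → ℝ} {a b c d : ℝ} (hab : a ≤ b) (hcd : c ≤ d)
    (hf : ContinuousOn (fun p : ℝ × ℝ => f p.1 p.2) (Set.Icc a b ×ˢ Set.Icc c d)) :
    ∃ g : ℝ → ℝ → ℝ, Continuous (Function.uncurry g) ∧
      ∀ t ∈ Set.Icc a b, ∀ x ∈ Set.Icc c d, g t x = f t x := by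
  refine ⟨fun t x => f (Set.projIcc a b hab t) (Set.projIcc c d hcd x), ?_, ?_⟩
  · have hproj : Continuous fun p : ℝ × ℝ =>
        (((Set.projIcc a b hab p.1 : ℝ), (Set.projIcc c d hcd p.2 : ℝ)) : ℝ × ℝ) := by
      have h1 := continuous_subtype_val.comp (continuous_projIcc (h := hab))
      have h2 := continuous_subtype_val.comp (continuous_projIcc (h := hcd))
      exact (h1.comp continuous_fst).prodMk (h2.comp continuous_snd)
    exact hf.comp_continuous hproj fun p => ⟨Subtype.coe_prop _, Subtype.coe_prop _⟩
  · intro t ht x hx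
    simp only [Set.projIcc_of_mem hab ht, Set.projIcc_of_mem hcd hx]

lemma continuousOn_slice_fst {f : ℝ → ℝ → ℝ} {a b c d x : ℝ}
    (hf : ContinuousOn (fun p : ℝ × ℝ => f p.1 p.2) (Set.Icc a b ×ˢ Set.Icc c d))
    (hx : x ∈ Set.Icc c d) : ContinuousOn (fun t => f t x) (Set.Icc a b) :=
  hf.comp (f := fun t : ℝ => (t, x)) (by fun_prop) fun _ ht => ⟨ht, hx⟩

lemma continuousOn_slice_snd {f : ℝ → ℝ → ℝ} {a b c d t : ℝ}
    (hf : ContinuousOn (fun p : ℝ × ℝ => f p.1 p.2) (Set.Icc a b ×ˢ Set.Icc c d))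
    (ht : t ∈ Set.Icc a b) : ContinuousOn (fun x => f t x) (Set.Icc c d) :=
  hf.comp (f := fun x : ℝ => (t, x)) (by fun_prop) fun _ hx => ⟨ht, hx⟩

lemma integral_integral_swap_of_continuousOn {f : ℝ → ℝ → ℝ} {a b c d : ℝ} (hab : a ≤ b)
    (hcd : c ≤ d) (hf : ContinuousOn (fun p : ℝ × ℝ => f p.1 p.2) (Set.Icc a b ×ˢ Set.Icc c d)) :
    (∫ x in c..d, ∫ t in a..b, f t x) = ∫ t in a..b, ∫ x in c..d, f t x := by
  have hint : Integrable (fun p : ℝ × ℝ => f p.1 p.2)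
      ((volume.restrict (Set.Ioc a b)).prod (volume.restrict (Set.Ioc c d))) := by
    rw [Measure.prod_restrict]
    exact (hf.integrableOn_compact (isCompact_Icc.prod isCompact_Icc)).mono_set
      (Set.prod_mono Set.Ioc_subset_Icc_self Set.Ioc_subset_Icc_self)
  simp only [integral_of_le hab, integral_of_le hcd]
  exact (MeasureTheory.integral_integral_swap hint).symm

lemma continuousOn_integral_snd {f : ℝ → ℝ → ℝ} {a b c d : ℝ} (hab : a ≤ b) (hcd : c ≤ d)
    (hf : ContinuousOn (fun p : ℝ × ℝ => f p.1 p.2) (Set.Icc a b ×ˢ Set.Icc c d)) :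
    ContinuousOn (fun t => ∫ x in c..d, f t x) (Set.Icc a b) := by
  obtain ⟨g, hg, hgf⟩ := exists_continuous_eq_on_rectangle hab hcd hf
  refine (continuous_parametric_intervalIntegral_of_continuous' (μ := volume)
    hg c d).continuousOn.congr ?_
  intro t ht
  refine integral_congr fun x hx => ?_
  rw [Set.uIcc_of_le hcd] at hx
  exact (hgf t ht x hx).symm

/-- Exchange of mixed partial derivatives: if `ftx = ∂ₓ ∂ₜ f` is continuous, then
`∂ₜ ∂ₓ f` exists and equals it. -/
lemma hasDerivAt_mixed {f ft fx ftx : ℝ → ℝ → ℝ} {a b c d : ℝ} (hcd : c < d)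
    (hf : ContinuousOn (fun p : ℝ × ℝ => f p.1 p.2) (Set.Icc a b ×ˢ Set.Icc c d))
    (hft_cont : ContinuousOn (fun p : ℝ × ℝ => ft p.1 p.2) (Set.Icc a b ×ˢ Set.Icc c d))
    (hftx_cont : ContinuousOn (fun p : ℝ × ℝ => ftx p.1 p.2) (Set.Icc a b ×ˢ Set.Icc c d))
    (hft : ∀ t ∈ Set.Ioo a b, ∀ x ∈ Set.Icc c d, HasDerivAt (fun s => f s x) (ft t x) t)
    (hfx : ∀ t ∈ Set.Icc a b, ∀ x ∈ Set.Icc c d, HasDerivAt (fun ξ => f t ξ) (fx t x) x)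
    (hftx : ∀ t ∈ Set.Icc a b, ∀ x ∈ Set.Icc c d, HasDerivAt (fun ξ => ft t ξ) (ftx t x) x) :
    ∀ t ∈ Set.Ioo a b, ∀ x ∈ Set.Icc c d, HasDerivAt (fun s => fx s x) (ftx t x) t := by
  intro t₀ ht₀ x₀ hx₀
  have hab : a ≤ b := (ht₀.1.trans ht₀.2).le
  obtain ⟨g, hg, hgf⟩ := exists_continuous_eq_on_rectangle hab hcd.le hftx_cont
  have key : ∀ t ∈ Set.Icc a b, ∀ x ∈ Set.Icc c d, fx t x - fx a x = ∫ τ in a..t, g τ x := by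
    intro t ht x hx
    have hsub : Set.Icc a t ⊆ Set.Icc a b := Set.Icc_subset_Icc_right ht.2
    have ftc : ∀ z ∈ Set.Icc c d, (∫ τ in a..t, ft τ z) = f t z - f a z := by
      intro z hz
      refine integral_eq_sub_of_hasDerivAt_of_le ht.1
        ((continuousOn_slice_fst hf hz).mono hsub)
        (fun τ hτ => hft τ ⟨hτ.1, hτ.2.trans_le ht.2⟩ z hz) ?_
      exact ((continuousOn_slice_fst hft_cont hz).mono hsub).intervalIntegrable_of_Icc ht.1
    have prim : ∀ z ∈ Set.Icc c d, (∫ ξ in c..z, ∫ τ in a..t, g τ ξ)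
        = (f t z - f a z) - (f t c - f a c) := by
      intro z hz
      have hsubz : Set.Icc c z ⊆ Set.Icc c d := Set.Icc_subset_Icc_right hz.2
      rw [integral_integral_swap_of_continuousOn ht.1 hz.1 hg.continuousOn,
        ← ftc z hz, ← ftc c ⟨le_rfl, hcd.le⟩, ← intervalIntegral.integral_sub]
      · refine integral_congr fun τ hτ => ?_
        rw [Set.uIcc_of_le ht.1] at hτ
        refine integral_eq_sub_of_hasDerivAt_of_le hz.1
          ((continuousOn_slice_snd hft_cont (hsub hτ)).mono hsubz) (fun ξ hξ => ?_) ?_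
        · rw [hgf τ (hsub hτ) ξ (hsubz (Set.Ioo_subset_Icc_self hξ))]
          exact hftx τ (hsub hτ) ξ (hsubz (Set.Ioo_subset_Icc_self hξ))
        · exact (hg.comp (Continuous.prodMk_right τ)).intervalIntegrable _ _
      · exact ((continuousOn_slice_fst hft_cont hz).mono hsub).intervalIntegrable_of_Icc ht.1
      · exact ((continuousOn_slice_fst hft_cont ⟨le_rfl, hcd.le⟩).mono
          hsub).intervalIntegrable_of_Icc ht.1
    have hH : Continuous fun ξ => ∫ τ in a..t, g τ ξ :=
      continuous_parametric_intervalIntegral_of_continuous' (f := fun ξ τ => g τ ξ)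
        (hg.comp continuous_swap) a t
    have d1 : HasDerivWithinAt (fun z => ∫ ξ in c..z, ∫ τ in a..t, g τ ξ)
        (∫ τ in a..t, g τ x) (Set.Icc c d) x :=
      (hH.integral_hasStrictDerivAt c x).hasDerivAt.hasDerivWithinAt
    have d2 : HasDerivWithinAt (fun z => ∫ ξ in c..z, ∫ τ in a..t, g τ ξ)
        (fx t x - fx a x) (Set.Icc c d) x := by
      refine HasDerivWithinAt.congr_of_mem ?_ prim hx
      exact (((hfx t ht x hx).sub (hfx a ⟨le_rfl, hab⟩ x hx)).sub_const _).hasDerivWithinAt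
    exact (uniqueDiffOn_Icc hcd x hx).eq_deriv _ d2 d1
  have hd : HasDerivAt (fun t => fx a x₀ + ∫ τ in a..t, g τ x₀) (g t₀ x₀) t₀ :=
    ((Continuous.integral_hasStrictDerivAt
      (hg.comp (Continuous.prodMk_left x₀)) a t₀).hasDerivAt).const_add _
  rw [hgf t₀ (Set.Ioo_subset_Icc_self ht₀) x₀ hx₀] at hd
  refine hd.congr_of_eventuallyEq ?_
  filter_upwards [Icc_mem_nhds ht₀.1 ht₀.2] with t ht
  rw [← key t ht x₀ hx₀]
  ring

/-- Fundamental theorem of calculus in time, integrated in space; the integrand need not be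
controlled on the left endpoint of the space interval. -/
lemma integral_sub_eq_integral_integral {F G : ℝ → ℝ → ℝ} {a b c d : ℝ} (hab : a ≤ b)
    (hcd : c ≤ d)
    (hF_cont : ∀ x ∈ Set.Ioc c d, ContinuousOn (fun t => F t x) (Set.Icc a b))
    (hF : ∀ t ∈ Set.Ioo a b, ∀ x ∈ Set.Ioc c d, HasDerivAt (fun s => F s x) (G t x) t)
    (hG : ContinuousOn (fun p : ℝ × ℝ => G p.1 p.2) (Set.Icc a b ×ˢ Set.Icc c d))
    (ha : IntervalIntegrable (F a) volume c d) (hb : IntervalIntegrable (F b) volume c d) :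
    (∫ x in c..d, F b x) - ∫ x in c..d, F a x = ∫ t in a..b, ∫ x in c..d, G t x := by
  rw [← integral_integral_swap_of_continuousOn hab hcd hG, ← intervalIntegral.integral_sub hb ha]
  refine integral_congr_ae (Filter.Eventually.of_forall fun x hx => ?_)
  rw [Set.uIoc_of_le hcd] at hx
  exact (integral_eq_sub_of_hasDerivAt_of_le hab (hF_cont x hx) (fun t ht => hF t ht x hx)
    ((continuousOn_slice_fst hG (Set.Ioc_subset_Icc_self hx)).intervalIntegrable_of_Icc hab)).symm

/-- If `x |a'| ≤ K a` with `K < 2`, then `x² / a` extends continuously by `0` to the origin. -/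
lemma continuousOn_sq_div {a a' : ℝ → ℝ} {K : ℝ} (hK2 : K < 2)
    (ha_cont : ContinuousOn a (Set.Icc 0 1))
    (ha_pos : ∀ x ∈ Set.Ioc (0:ℝ) 1, 0 < a x)
    (ha_deriv : ∀ x ∈ Set.Ioc (0:ℝ) 1, HasDerivAt a (a' x) x)
    (hKbound : ∀ x ∈ Set.Ioc (0:ℝ) 1, x * |a' x| ≤ K * a x) :
    ContinuousOn (fun x => x ^ 2 / a x) (Set.Icc 0 1) := by
  have hder : ∀ x ∈ Set.Ioc (0:ℝ) 1, HasDerivAt (fun z => z ^ K / a z)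
      ((K * x ^ (K - 1) * a x - x ^ K * a' x) / a x ^ 2) x := fun x hx =>
    (Real.hasDerivAt_rpow_const (Or.inl hx.1.ne')).div (ha_deriv x hx) (ha_pos x hx).ne'
  have hmono : MonotoneOn (fun z => z ^ K / a z) (Set.Ioc 0 1) := by
    refine monotoneOn_of_deriv_nonneg (convex_Ioc 0 1)
      (fun x hx => (hder x hx).continuousAt.continuousWithinAt) ?_ ?_
    · intro x hx
      exact (hder x (interior_subset hx)).differentiableAt.differentiableWithinAt
    · intro x hx
      have hx := interior_subset hx
      rw [(hder x hx).deriv]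
      have hpow : x ^ K = x ^ (K - 1) * x := by
        rw [← Real.rpow_add_one hx.1.ne']; ring_nf
      have h0 : 0 ≤ x ^ (K - 1) := Real.rpow_nonneg hx.1.le _
      have h1 : x * a' x ≤ K * a x :=
        (mul_le_mul_of_nonneg_left (le_abs_self _) hx.1.le).trans (hKbound x hx)
      refine div_nonneg ?_ (sq_nonneg _)
      rw [hpow]
      nlinarith [mul_le_mul_of_nonneg_left h1 h0]
  have hbound : ∀ x ∈ Set.Icc (0:ℝ) 1, x ^ 2 / a x ≤ x ^ (2 - K) / a 1 := by
    intro x hx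
    rcases hx.1.eq_or_lt with rfl | h0
    · rw [Real.zero_rpow (by linarith)]; simp
    · have h1 : x ^ K / a x ≤ 1 ^ K / a 1 := hmono ⟨h0, hx.2⟩ (by simp) hx.2
      have h2 : x ^ 2 = x ^ (2 - K) * x ^ K := by
        rw [← Real.rpow_add h0]; norm_num
      rw [h2, mul_div_assoc]
      calc _ ≤ x ^ (2 - K) * (1 ^ K / a 1) :=
            mul_le_mul_of_nonneg_left h1 (Real.rpow_nonneg h0.le _)
        _ = _ := by rw [Real.one_rpow]; ring
  intro x hx
  rcases hx.1.eq_or_lt with rfl | h0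
  · have hlim : Filter.Tendsto (fun x : ℝ => x ^ (2 - K) / a 1) (nhdsWithin 0 (Set.Icc 0 1))
        (nhds 0) := by
      have h : ContinuousAt (fun x : ℝ => x ^ (2 - K) / a 1) 0 :=
        (Real.continuousAt_rpow_const 0 (2 - K) (Or.inr (by linarith))).div_const _
      have h' := h.tendsto
      rw [Real.zero_rpow (by linarith), zero_div] at h'
      exact h'.mono_left nhdsWithin_le_nhds
    have hz : (fun x : ℝ => x ^ 2 / a x) 0 = 0 := by simp
    unfold ContinuousWithinAt
    rw [hz]
    refine tendsto_of_tendsto_of_tendsto_of_le_of_le' tendsto_const_nhds hlim ?_ ?_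
    · filter_upwards [self_mem_nhdsWithin] with z hz
      rcases hz.1.eq_or_lt with rfl | hz0
      · simp
      · exact div_nonneg (sq_nonneg _) (ha_pos z ⟨hz0, hz.2⟩).le
    · filter_upwards [self_mem_nhdsWithin] with z hz using hbound z hz
  · exact ((continuous_pow 2).continuousWithinAt).div (ha_cont x hx) (ha_pos x ⟨h0, hx.2⟩).ne'

lemma abs_le_mul_of_hasDerivAt {v v' : ℝ → ℝ} {M : ℝ}
    (hv : ∀ x ∈ Set.Icc (0:ℝ) 1, HasDerivAt v (v' x) x) (hv0 : v 0 = 0)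
    (hM : ∀ x ∈ Set.Icc (0:ℝ) 1, |v' x| ≤ M) : ∀ x ∈ Set.Icc (0:ℝ) 1, |v x| ≤ M * x := by
  intro x hx
  have h := (convex_Icc (0:ℝ) 1).norm_image_sub_le_of_norm_hasDerivWithin_le
    (fun z hz => (hv z hz).hasDerivWithinAt) hM ⟨le_rfl, zero_le_one⟩ hx
  simpa [hv0, abs_of_nonneg hx.1] using h

lemma intervalIntegrable_sq_div {a v v' : ℝ → ℝ}
    (ha_cont : ContinuousOn a (Set.Icc 0 1))
    (ha_pos : ∀ x ∈ Set.Ioc (0:ℝ) 1, 0 < a x)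
    (hb : ContinuousOn (fun x => x ^ 2 / a x) (Set.Icc 0 1))
    (hv : ∀ x ∈ Set.Icc (0:ℝ) 1, HasDerivAt v (v' x) x)
    (hv' : ContinuousOn v' (Set.Icc 0 1)) (hv0 : v 0 = 0) :
    IntervalIntegrable (fun x => v x ^ 2 / a x) volume 0 1 := by
  obtain ⟨M, hM⟩ := isCompact_Icc.exists_bound_of_continuousOn hv'
  have hle := abs_le_mul_of_hasDerivAt hv hv0 hM
  have hbi : IntervalIntegrable (fun x => M ^ 2 * (x ^ 2 / a x)) volume 0 1 :=
    (hb.intervalIntegrable_of_Icc zero_le_one).const_mul _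
  rw [intervalIntegrable_iff_integrableOn_Ioc_of_le zero_le_one] at hbi ⊢
  refine Integrable.mono' hbi ?_ ?_
  · refine ContinuousOn.aestronglyMeasurable (fun x hx => ?_) measurableSet_Ioc
    have hx' := Set.Ioc_subset_Icc_self hx
    exact ((hv x hx').continuousAt.continuousWithinAt.pow 2).div
      ((ha_cont x hx').mono Set.Ioc_subset_Icc_self) (ha_pos x hx).ne'
  · refine (ae_restrict_iff' measurableSet_Ioc).2 (Filter.Eventually.of_forall fun x hx => ?_)
    have ha := ha_pos x hx
    rw [Real.norm_of_nonneg (div_nonneg (sq_nonneg _) ha.le), ← mul_div_assoc]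
    refine div_le_div_of_nonneg_right ?_ ha.le
    have h := hle x (Set.Ioc_subset_Icc_self hx)
    calc v x ^ 2 = |v x| ^ 2 := (sq_abs _).symm
      _ ≤ (M * x) ^ 2 := pow_le_pow_left₀ (abs_nonneg _) h 2
      _ = _ := by ring

/-- Pairing of `u` with a cubic vanishing to second order at the origin in the weighted space,
estimated through Young's inequality and the weighted Hardy inequality. -/
lemma abs_integral_mul_cubic_div_le {a u : ℝ → ℝ} {C κ : ℝ} (p q : ℝ) (hC : 0 < C) (hκ : 0 < κ)
    (ha_pos : ∀ x ∈ Set.Ioc (0:ℝ) 1, 0 < a x)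
    (hb : ContinuousOn (fun x => x ^ 2 / a x) (Set.Icc 0 1))
    (hHardy : ∀ v v' : ℝ → ℝ,
      (∀ x ∈ Set.Icc (0:ℝ) 1, HasDerivAt v (v' x) x) →
      ContinuousOn v' (Set.Icc 0 1) → v 0 = 0 →
      (∫ x in (0:ℝ)..1, (v x) ^ 2 / a x) ≤ C * ∫ x in (0:ℝ)..1, (v' x) ^ 2)
    (hu : ContinuousOn u (Set.Icc 0 1))
    (hua : IntervalIntegrable (fun x => u x ^ 2 / a x) volume 0 1) :
    |∫ x in (0:ℝ)..1, u x * (p + q * x) * (x ^ 2 / a x)| ≤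
      κ * (∫ x in (0:ℝ)..1, u x ^ 2 / a x)
        + C / (8 * κ) * (4 * p ^ 2 + 12 * p * q + 12 * q ^ 2) := by
  have hw := hHardy (fun x => p * x ^ 2 + q * x ^ 3) (fun x => 2 * p * x + 3 * q * x ^ 2)
    (fun x _ => by
      have h := ((hasDerivAt_pow 2 x).const_mul p).add ((hasDerivAt_pow 3 x).const_mul q)
      exact h.congr_deriv (by push_cast; ring)) (by fun_prop) (by simp)
  have hcalc : (∫ x in (0:ℝ)..1, (2 * p * x + 3 * q * x ^ 2) ^ 2)
      = 4 * p ^ 2 / 3 + 3 * p * q + 9 * q ^ 2 / 5 := by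
    have h : ∀ x ∈ Set.uIcc (0:ℝ) 1, HasDerivAt
        (fun x => 4 * p ^ 2 / 3 * x ^ 3 + 3 * p * q * x ^ 4 + 9 * q ^ 2 / 5 * x ^ 5)
        ((2 * p * x + 3 * q * x ^ 2) ^ 2) x := fun x _ => by
      have h := (((hasDerivAt_pow 3 x).const_mul (4 * p ^ 2 / 3)).add
        ((hasDerivAt_pow 4 x).const_mul (3 * p * q))).add
        ((hasDerivAt_pow 5 x).const_mul (9 * q ^ 2 / 5))
      exact h.congr_deriv (by push_cast; ring)
    rw [integral_eq_sub_of_hasDerivAt h (Continuous.intervalIntegrable (by fun_prop) _ _)]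
    ring
  rw [hcalc] at hw
  have hwi : IntervalIntegrable (fun x => (p * x ^ 2 + q * x ^ 3) ^ 2 / a x) volume 0 1 := by
    have h : ContinuousOn (fun x => (p * x + q * x ^ 2) ^ 2 * (x ^ 2 / a x)) (Set.Icc 0 1) :=
      ContinuousOn.mul (by fun_prop) hb
    refine (h.intervalIntegrable_of_Icc zero_le_one).congr fun x _ => ?_
    ring
  have hLi : IntervalIntegrable (fun x => u x * (p + q * x) * (x ^ 2 / a x)) volume 0 1 :=
    ((hu.mul (by fun_prop)).mul hb).intervalIntegrable_of_Icc zero_le_one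
  have hRi := (hua.const_mul κ).add (hwi.const_mul (1 / (4 * κ)))
  have hR : (∫ x in (0:ℝ)..1, (κ * (u x ^ 2 / a x)
        + 1 / (4 * κ) * ((p * x ^ 2 + q * x ^ 3) ^ 2 / a x)))
      ≤ κ * (∫ x in (0:ℝ)..1, u x ^ 2 / a x)
        + C / (8 * κ) * (4 * p ^ 2 + 12 * p * q + 12 * q ^ 2) := by
    rw [intervalIntegral.integral_add (hua.const_mul κ) (hwi.const_mul _),
      intervalIntegral.integral_const_mul, intervalIntegral.integral_const_mul]
    have h1 := mul_le_mul_of_nonneg_left hw (show 0 ≤ 1 / (4 * κ) by positivity)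
    have h2 : C / (8 * κ) * (4 * p ^ 2 + 12 * p * q + 12 * q ^ 2)
        - 1 / (4 * κ) * (C * (4 * p ^ 2 / 3 + 3 * p * q + 9 * q ^ 2 / 5))
        = C / (8 * κ) * (4 / 3 * (p + 9 / 4 * q) ^ 2 + 33 / 20 * q ^ 2) := by
      field_simp; ring
    have h3 : 0 ≤ C / (8 * κ) * (4 / 3 * (p + 9 / 4 * q) ^ 2 + 33 / 20 * q ^ 2) := by positivity
    linarith
  have hpt : ∀ x ∈ Set.Ioo (0:ℝ) 1, |u x * (p + q * x) * (x ^ 2 / a x)| ≤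
      κ * (u x ^ 2 / a x) + 1 / (4 * κ) * ((p * x ^ 2 + q * x ^ 3) ^ 2 / a x) := by
    intro x hx
    have ha := ha_pos x (Set.Ioo_subset_Ioc_self hx)
    have e1 : κ * (u x ^ 2 / a x) + 1 / (4 * κ) * ((p * x ^ 2 + q * x ^ 3) ^ 2 / a x)
        - u x * (p + q * x) * (x ^ 2 / a x)
        = (2 * κ * u x - (p * x ^ 2 + q * x ^ 3)) ^ 2 / (4 * κ * a x) := by
      field_simp; ring
    have e2 : κ * (u x ^ 2 / a x) + 1 / (4 * κ) * ((p * x ^ 2 + q * x ^ 3) ^ 2 / a x)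
        + u x * (p + q * x) * (x ^ 2 / a x)
        = (2 * κ * u x + (p * x ^ 2 + q * x ^ 3)) ^ 2 / (4 * κ * a x) := by
      field_simp; ring
    have n1 : 0 ≤ (2 * κ * u x - (p * x ^ 2 + q * x ^ 3)) ^ 2 / (4 * κ * a x) := by positivity
    have n2 : 0 ≤ (2 * κ * u x + (p * x ^ 2 + q * x ^ 3)) ^ 2 / (4 * κ * a x) := by positivity
    exact abs_le.2 ⟨by linarith, by linarith⟩
  calc _ ≤ ∫ x in (0:ℝ)..1, |u x * (p + q * x) * (x ^ 2 / a x)| :=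
        intervalIntegral.abs_integral_le_integral_abs zero_le_one
    _ ≤ _ := (integral_mono_on_of_le_Ioo zero_le_one hLi.abs hRi hpt).trans hR

/-- Boundary values at `1` of a function clamped at `0` are controlled by its second derivative. -/
lemma sq_le_integral_sq_of_clamped {z z' z'' : ℝ → ℝ}
    (hz : ∀ x ∈ Set.Icc (0:ℝ) 1, HasDerivAt z (z' x) x)
    (hz' : ∀ x ∈ Set.Icc (0:ℝ) 1, HasDerivAt z' (z'' x) x)
    (hz'' : ContinuousOn z'' (Set.Icc 0 1)) (h0 : z 0 = 0) (h0' : z' 0 = 0) :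
    z 1 ^ 2 ≤ (∫ x in (0:ℝ)..1, z'' x ^ 2) ∧ z' 1 ^ 2 ≤ ∫ x in (0:ℝ)..1, z'' x ^ 2 := by
  have hsq : IntervalIntegrable (fun x => z'' x ^ 2) volume 0 1 :=
    (hz''.pow 2).intervalIntegrable_of_Icc zero_le_one
  constructor
  · have hc : IntervalIntegrable (fun x => 2 * z 1 * ((1 - x) * z'' x) - z 1 ^ 2 * (1 - x) ^ 2)
        volume 0 1 := by
      refine ContinuousOn.intervalIntegrable_of_Icc zero_le_one ?_
      fun_prop
    have hd : ∀ x ∈ Set.uIcc (0:ℝ) 1, HasDerivAt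
        (fun x => 2 * z 1 * ((1 - x) * z' x + z x) + z 1 ^ 2 / 3 * (1 - x) ^ 3)
        (2 * z 1 * ((1 - x) * z'' x) - z 1 ^ 2 * (1 - x) ^ 2) x := by
      intro x hx
      rw [Set.uIcc_of_le zero_le_one] at hx
      have hl : HasDerivAt (fun x : ℝ => 1 - x) (-1) x := by
        simpa using (hasDerivAt_id x).const_sub 1
      have h := (((hl.mul (hz' x hx)).add (hz x hx)).const_mul (2 * z 1)).add
        ((hl.pow 3).const_mul (z 1 ^ 2 / 3))
      refine h.congr_deriv ?_
      push_cast; ring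
    have h := integral_mono_on zero_le_one hc hsq fun x _ => by
      nlinarith [sq_nonneg (z'' x - z 1 * (1 - x))]
    rw [integral_eq_sub_of_hasDerivAt hd hc] at h
    simp only [h0, h0'] at h
    nlinarith [sq_nonneg (z 1)]
  · have hc : IntervalIntegrable (fun x => 2 * z' 1 * z'' x - z' 1 ^ 2) volume 0 1 := by
      refine ContinuousOn.intervalIntegrable_of_Icc zero_le_one ?_
      fun_prop
    have hd : ∀ x ∈ Set.uIcc (0:ℝ) 1, HasDerivAt
        (fun x => 2 * z' 1 * z' x - z' 1 ^ 2 * x) (2 * z' 1 * z'' x - z' 1 ^ 2) x := by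
      intro x hx
      rw [Set.uIcc_of_le zero_le_one] at hx
      have h := ((hz' x hx).const_mul (2 * z' 1)).sub ((hasDerivAt_id x).const_mul (z' 1 ^ 2))
      refine h.congr_deriv ?_
      ring
    have h := integral_mono_on zero_le_one hc hsq fun x _ => by
      nlinarith [sq_nonneg (z'' x - z' 1)]
    rw [integral_eq_sub_of_hasDerivAt hd hc] at h
    simp only [h0'] at h
    nlinarith [sq_nonneg (z' 1)]

lemma two_mul_sq_le_of_eq_ite {β C : ℝ} (hC : C = if 0 < β then min 2 (2 / β) else 2)
    (hβ : 0 ≤ β) : 0 < C ∧ C ≤ 2 ∧ ∀ z A : ℝ, z ^ 2 ≤ A → 2 * z ^ 2 ≤ C * (A + β * z ^ 2) := by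
  by_cases h : 0 < β
  · rw [if_pos h] at hC
    refine ⟨hC ▸ lt_min two_pos (by positivity), hC ▸ min_le_left _ _, fun z A hz => ?_⟩
    have hz0 := sq_nonneg z
    have hβz : 0 ≤ β * z ^ 2 := by positivity
    rcases min_cases (2:ℝ) (2 / β) with ⟨h1, -⟩ | ⟨h1, -⟩ <;> rw [hC, h1]
    · linarith
    · rw [div_mul_eq_mul_div, le_div_iff₀ h]
      nlinarith
  · rw [if_neg h] at hC
    have hβ0 : β = 0 := le_antisymm (not_lt.1 h) hβ
    refine ⟨by linarith, hC.le, fun z A hz => ?_⟩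
    rw [hC, hβ0]; linarith

/-- The cubic `p x² + q x³` solving the auxiliary boundary value problem depends linearly on the
boundary data. -/
lemma exists_cubic_coefficients {β γ : ℝ} (hβ : 0 ≤ β) (hγ : 0 ≤ γ) :
    ∃ A₁ A₂ B₁ B₂ : ℝ, ∀ l m : ℝ,
      β * ((A₁ * l + A₂ * m) + (B₁ * l + B₂ * m)) - 6 * (B₁ * l + B₂ * m) = l ∧
      γ * (2 * (A₁ * l + A₂ * m) + 3 * (B₁ * l + B₂ * m))
        + (2 * (A₁ * l + A₂ * m) + 6 * (B₁ * l + B₂ * m)) = m := by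
  have hD : β * γ + 4 * β + 12 * γ + 12 ≠ 0 := by positivity
  refine ⟨(3 * γ + 6) / (β * γ + 4 * β + 12 * γ + 12), -(β - 6) / (β * γ + 4 * β + 12 * γ + 12),
    -(2 * γ + 2) / (β * γ + 4 * β + 12 * γ + 12), β / (β * γ + 4 * β + 12 * γ + 12),
    fun l m => ⟨?_, ?_⟩⟩ <;> field_simp <;> ring

/-- A priori bounds for the solution `p x² + q x³` of the auxiliary boundary value problem. -/
lemma cubic_bounds {β γ Cβ Cγ p q l m : ℝ} (hβ : 0 ≤ β) (hγ : 0 ≤ γ)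
    (hCβ : Cβ = if 0 < β then min 2 (2 / β) else 2)
    (hCγ : Cγ = if 0 < γ then min 2 (2 / γ) else 2)
    (h1 : β * (p + q) - 6 * q = l) (h2 : γ * (2 * p + 3 * q) + (2 * p + 6 * q) = m) :
    4 * p ^ 2 + 12 * p * q + 12 * q ^ 2 ≤ (Cβ + Cγ) / 2 * (l ^ 2 + m ^ 2) ∧
    (p + q) ^ 2 + (2 * p + 3 * q) ^ 2 ≤ (Cβ + Cγ) * (l ^ 2 + m ^ 2) := by
  obtain ⟨pβ, lβ, kβ⟩ := two_mul_sq_le_of_eq_ite hCβ hβ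
  obtain ⟨pγ, lγ, kγ⟩ := two_mul_sq_le_of_eq_ite hCγ hγ
  set N₀ := 4 * p ^ 2 + 12 * p * q + 12 * q ^ 2 with hN₀
  set v := p + q with hv
  set w := 2 * p + 3 * q with hw
  have hv0 : v ^ 2 ≤ N₀ := by
    have : N₀ - v ^ 2 = 3 * (p + 5 / 3 * q) ^ 2 + 8 / 3 * q ^ 2 := by rw [hN₀, hv]; ring
    nlinarith [sq_nonneg (p + 5 / 3 * q), sq_nonneg q]
  have hw0 : w ^ 2 ≤ N₀ := by
    have : N₀ - w ^ 2 = 3 * q ^ 2 := by rw [hN₀, hw]; ring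
    nlinarith [sq_nonneg q]
  have hβv : 0 ≤ β * v ^ 2 := by positivity
  have hγw : 0 ≤ γ * w ^ 2 := by positivity
  have hN₀0 : 0 ≤ N₀ := (sq_nonneg v).trans hv0
  obtain ⟨N, hN⟩ : ∃ N, N = N₀ + β * v ^ 2 + γ * w ^ 2 := ⟨_, rfl⟩
  have hid : N = l * v + m * w := by rw [hN, ← h1, ← h2, hN₀, hv, hw]; ring
  have kv : 2 * v ^ 2 ≤ Cβ * N :=
    (kβ v N₀ hv0).trans (mul_le_mul_of_nonneg_left (by linarith) pβ.le)
  have kw : 2 * w ^ 2 ≤ Cγ * N :=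
    (kγ w N₀ hw0).trans (mul_le_mul_of_nonneg_left (by linarith) pγ.le)
  have hNN : 0 ≤ N := by linarith
  have hR : 0 ≤ l ^ 2 + m ^ 2 := by positivity
  have hsq : N ^ 2 ≤ (l ^ 2 + m ^ 2) * (v ^ 2 + w ^ 2) := by
    rw [hid]; nlinarith [sq_nonneg (l * w - m * v)]
  have hNle : N ≤ (Cβ + Cγ) / 2 * (l ^ 2 + m ^ 2) := by
    rcases hNN.eq_or_lt with h | h
    · rw [← h]; positivity
    · have h3 := mul_le_mul_of_nonneg_left
        (show v ^ 2 + w ^ 2 ≤ (Cβ + Cγ) / 2 * N by linarith) hR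
      refine le_of_mul_le_mul_right ?_ h
      nlinarith
  refine ⟨by linarith, ?_⟩
  have h4 : (Cβ + Cγ) / 2 * N ≤ 2 * N := mul_le_mul_of_nonneg_right (by linarith) hNN
  linarith

lemma coupling_constant_eq {β γ Cβ Cγ ν δ Cδ : ℝ}
    (hCβ : Cβ = if 0 < β then min 2 (2 / β) else 2)
    (hCγ : Cγ = if 0 < γ then min 2 (2 / γ) else 2)
    (hν : ν = if 1 < β then
        (if 1 < γ then β * γ / (2 * (β + γ)) else β / (2 * (β + 1)))
      else
        (if 1 < γ then γ / (2 * (1 + γ)) else 1/4)) (hδν : δ < ν)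
    (hCδ : Cδ = if 1 < β then
        (if 1 < γ then 1 - 2 * δ * (1/β + 1/γ) else 1 - 2 * δ * (1/β + 1))
      else
        (if 1 < γ then 1 - 2 * δ * (1 + 1/γ) else 1 - 4 * δ)) :
    Cδ = 1 - δ * (Cβ + Cγ) ∧ 0 < Cδ := by
  have hbig : ∀ {b C : ℝ}, (C = if 0 < b then min 2 (2 / b) else 2) → 1 < b → C = 2 / b := by
    intro b C h hb
    rw [h, if_pos (by linarith), min_eq_right]
    rw [div_le_iff₀ (by linarith)]; linarith
  have hsmall : ∀ {b C : ℝ}, (C = if 0 < b then min 2 (2 / b) else 2) → ¬ 1 < b → C = 2 := by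
    intro b C h hb
    split_ifs at h with h0
    · rw [h, min_eq_left]
      rw [le_div_iff₀ h0]; linarith
    · exact h
  by_cases b1 : 1 < β <;> by_cases g1 : 1 < γ <;>
    simp only [b1, g1, if_true, if_false] at hν hCδ
  · have hb0 : 0 < β := by linarith
    have hg0 : 0 < γ := by linarith
    rw [hbig hCβ b1, hbig hCγ g1, hCδ]
    refine ⟨by ring, ?_⟩
    rw [hν, lt_div_iff₀ (by positivity)] at hδν
    have : 1 - 2 * δ * (1 / β + 1 / γ) = (β * γ - δ * (2 * (β + γ))) / (β * γ) := by
      field_simp; ring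
    rw [this]; exact div_pos (by linarith) (by positivity)
  · have hb0 : 0 < β := by linarith
    rw [hbig hCβ b1, hsmall hCγ g1, hCδ]
    refine ⟨by ring, ?_⟩
    rw [hν, lt_div_iff₀ (by positivity)] at hδν
    have : 1 - 2 * δ * (1 / β + 1) = (β - δ * (2 * (β + 1))) / β := by
      field_simp; ring
    rw [this]; exact div_pos (by linarith) (by positivity)
  · have hg0 : 0 < γ := by linarith
    rw [hsmall hCβ b1, hbig hCγ g1, hCδ]
    refine ⟨by ring, ?_⟩
    rw [hν, lt_div_iff₀ (by positivity)] at hδν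
    have : 1 - 2 * δ * (1 + 1 / γ) = (γ - δ * (2 * (1 + γ))) / γ := by
      field_simp; ring
    rw [this]; exact div_pos (by linarith) (by positivity)
  · rw [hsmall hCβ b1, hsmall hCγ g1, hCδ]
    exact ⟨by ring, by linarith⟩

/-- Energy dissipation: the energy of a solution decreases at the rate of the boundary damping. -/
lemma energy_sub_eq
    {T β γ : ℝ} {a : ℝ → ℝ}
    {y yt ytt yx yxx yxxx yxxxx ytx ytxx : ℝ → ℝ → ℝ} {E : ℝ → ℝ}
    (ha_pos : ∀ x ∈ Set.Ioc (0:ℝ) 1, 0 < a x)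
    (hyt : ∀ t ∈ Set.Icc (0:ℝ) T, ∀ x ∈ Set.Icc (0:ℝ) 1,
      HasDerivAt (fun s => y s x) (yt t x) t)
    (hytt : ∀ t ∈ Set.Icc (0:ℝ) T, ∀ x ∈ Set.Icc (0:ℝ) 1,
      HasDerivAt (fun s => yt s x) (ytt t x) t)
    (hyxxx : ∀ t ∈ Set.Icc (0:ℝ) T, ∀ x ∈ Set.Icc (0:ℝ) 1,
      HasDerivAt (fun ξ => yxx t ξ) (yxxx t x) x)
    (hyxxxx : ∀ t ∈ Set.Icc (0:ℝ) T, ∀ x ∈ Set.Icc (0:ℝ) 1,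
      HasDerivAt (fun ξ => yxxx t ξ) (yxxxx t x) x)
    (hytx : ∀ t ∈ Set.Icc (0:ℝ) T, ∀ x ∈ Set.Icc (0:ℝ) 1,
      HasDerivAt (fun ξ => yt t ξ) (ytx t x) x)
    (hytxx : ∀ t ∈ Set.Icc (0:ℝ) T, ∀ x ∈ Set.Icc (0:ℝ) 1,
      HasDerivAt (fun ξ => ytx t ξ) (ytxx t x) x)
    (hyx_t : ∀ t ∈ Set.Ioo (0:ℝ) T, ∀ x ∈ Set.Icc (0:ℝ) 1,
      HasDerivAt (fun s => yx s x) (ytx t x) t)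
    (hyxx_t : ∀ t ∈ Set.Ioo (0:ℝ) T, ∀ x ∈ Set.Icc (0:ℝ) 1,
      HasDerivAt (fun s => yxx s x) (ytxx t x) t)
    (cy : ContinuousOn (fun p : ℝ × ℝ => y p.1 p.2) (Set.Icc (0:ℝ) T ×ˢ Set.Icc 0 1))
    (cyt : ContinuousOn (fun p : ℝ × ℝ => yt p.1 p.2) (Set.Icc (0:ℝ) T ×ˢ Set.Icc 0 1))
    (cyx : ContinuousOn (fun p : ℝ × ℝ => yx p.1 p.2) (Set.Icc (0:ℝ) T ×ˢ Set.Icc 0 1))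
    (cyxx : ContinuousOn (fun p : ℝ × ℝ => yxx p.1 p.2) (Set.Icc (0:ℝ) T ×ˢ Set.Icc 0 1))
    (cyxxxx : ContinuousOn (fun p : ℝ × ℝ => yxxxx p.1 p.2) (Set.Icc (0:ℝ) T ×ˢ Set.Icc 0 1))
    (cytx : ContinuousOn (fun p : ℝ × ℝ => ytx p.1 p.2) (Set.Icc (0:ℝ) T ×ˢ Set.Icc 0 1))
    (cytxx : ContinuousOn (fun p : ℝ × ℝ => ytxx p.1 p.2) (Set.Icc (0:ℝ) T ×ˢ Set.Icc 0 1))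
    (heq : ∀ t ∈ Set.Icc (0:ℝ) T, ∀ x ∈ Set.Ioc (0:ℝ) 1,
      ytt t x + a x * yxxxx t x = 0)
    (hyt0 : ∀ t ∈ Set.Icc (0:ℝ) T, yt t 0 = 0)
    (hytx0 : ∀ t ∈ Set.Ioo (0:ℝ) T, ytx t 0 = 0)
    (hbc1 : ∀ t ∈ Set.Icc (0:ℝ) T,
      β * y t 1 - yxxx t 1 + yt t 1 = 0 ∧ γ * yx t 1 + yxx t 1 + ytx t 1 = 0)
    (hyta : ∀ t ∈ Set.Icc (0:ℝ) T, IntervalIntegrable (fun x => yt t x ^ 2 / a x) volume 0 1)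
    (hE : ∀ t, E t = (1/2) * (∫ x in (0:ℝ)..1, ((yt t x) ^ 2 / a x + (yxx t x) ^ 2))
        + (β/2) * (y t 1) ^ 2 + (γ/2) * (yx t 1) ^ 2) :
    ∀ t₁ t₂ : ℝ, 0 ≤ t₁ → t₁ ≤ t₂ → t₂ ≤ T →
      E t₂ - E t₁ = -∫ t in t₁..t₂, ((yt t 1) ^ 2 + (ytx t 1) ^ 2) := by
  intro t₁ t₂ h1 h12 h2
  have one_mem : (1:ℝ) ∈ Set.Icc (0:ℝ) 1 := ⟨zero_le_one, le_rfl⟩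
  have hsub : Set.Icc t₁ t₂ ⊆ Set.Icc 0 T := Set.Icc_subset_Icc h1 h2
  have hsubo : Set.Ioo t₁ t₂ ⊆ Set.Ioo 0 T := Set.Ioo_subset_Ioo h1 h2
  have hrect : Set.Icc t₁ t₂ ×ˢ Set.Icc (0:ℝ) 1 ⊆ Set.Icc 0 T ×ˢ Set.Icc (0:ℝ) 1 :=
    Set.prod_mono hsub subset_rfl
  have hint : ∀ t ∈ Set.Icc (0:ℝ) T,
      IntervalIntegrable (fun x => yt t x ^ 2 / a x + yxx t x ^ 2) volume 0 1 := fun t ht =>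
    (hyta t ht).add
      (((continuousOn_slice_snd cyxx ht).pow 2).intervalIntegrable_of_Icc zero_le_one)
  have bulk := integral_sub_eq_integral_integral (F := fun t x => yt t x ^ 2 / a x + yxx t x ^ 2)
    (G := fun t x => 2 * (ytxx t x * yxx t x - yt t x * yxxxx t x)) h12 zero_le_one
    (fun x hx => by
      have hx' := Set.Ioc_subset_Icc_self hx
      exact ((((continuousOn_slice_fst cyt hx').mono hsub).pow 2).div_const _).add
        (((continuousOn_slice_fst cyxx hx').mono hsub).pow 2))
    (fun t ht x hx => by
      have hx' := Set.Ioc_subset_Icc_self hx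
      have hto := hsubo ht
      have htc := Set.Ioo_subset_Icc_self hto
      have h := (((hytt t htc x hx').pow 2).div_const (a x)).add ((hyxx_t t hto x hx').pow 2)
      refine h.congr_deriv ?_
      have hatt : ytt t x = -(a x * yxxxx t x) := by linarith [heq t htc x hx]
      have ha := (ha_pos x hx).ne'
      rw [hatt]
      field_simp
      ring)
    (by
      have hb1 := cytxx.mono hrect
      have hb2 := cyxx.mono hrect
      have hb3 := cyt.mono hrect
      have hb4 := cyxxxx.mono hrect
      fun_prop)
    (hint t₁ ⟨h1, h12.trans h2⟩) (hint t₂ ⟨h1.trans h12, h2⟩)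
  have space : ∀ t ∈ Set.Ioo t₁ t₂,
      (∫ x in (0:ℝ)..1, 2 * (ytxx t x * yxx t x - yt t x * yxxxx t x))
        = 2 * (ytx t 1 * yxx t 1 - yt t 1 * yxxx t 1) := by
    intro t ht
    have hto := hsubo ht
    have htc := Set.Ioo_subset_Icc_self hto
    rw [integral_eq_sub_of_hasDerivAt
      (f := fun x => 2 * (ytx t x * yxx t x - yt t x * yxxx t x))]
    · simp only [hyt0 t htc, hytx0 t hto]
      ring
    · intro x hx
      rw [Set.uIcc_of_le zero_le_one] at hx
      have h := (((hytxx t htc x hx).mul (hyxxx t htc x hx)).sub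
        ((hytx t htc x hx).mul (hyxxxx t htc x hx))).const_mul 2
      refine h.congr_deriv ?_
      ring
    · have hb1 := continuousOn_slice_snd cytxx htc
      have hb2 := continuousOn_slice_snd cyxx htc
      have hb3 := continuousOn_slice_snd cyt htc
      have hb4 := continuousOn_slice_snd cyxxxx htc
      exact ContinuousOn.intervalIntegrable_of_Icc zero_le_one (by fun_prop)
  rw [integral_congr_Ioo_of_le h12 space] at bulk
  have hb1 := (continuousOn_slice_fst cy one_mem).mono hsub
  have hb2 := (continuousOn_slice_fst cyt one_mem).mono hsub
  have hb3 := (continuousOn_slice_fst cyx one_mem).mono hsub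
  have hb4 := (continuousOn_slice_fst cytx one_mem).mono hsub
  have hc : IntervalIntegrable
      (fun t => β * (y t 1 * yt t 1) + γ * (yx t 1 * ytx t 1)) volume t₁ t₂ :=
    ContinuousOn.intervalIntegrable_of_Icc h12 (by fun_prop)
  have hd : IntervalIntegrable (fun t => yt t 1 ^ 2 + ytx t 1 ^ 2) volume t₁ t₂ :=
    ContinuousOn.intervalIntegrable_of_Icc h12 (by fun_prop)
  have bdry := integral_eq_sub_of_hasDerivAt_of_le
    (f := fun t => β / 2 * y t 1 ^ 2 + γ / 2 * yx t 1 ^ 2) h12 (by fun_prop)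
    (fun t ht => by
      have hto := hsubo ht
      have h := (((hyt t (Set.Ioo_subset_Icc_self hto) 1 one_mem).pow 2).const_mul (β / 2)).add
        (((hyx_t t hto 1 one_mem).pow 2).const_mul (γ / 2))
      refine h.congr_deriv ?_
      push_cast
      show _ = β * (y t 1 * yt t 1) + γ * (yx t 1 * ytx t 1)
      ring) hc
  have hsplit : (∫ t in t₁..t₂, 2 * (ytx t 1 * yxx t 1 - yt t 1 * yxxx t 1))
      = -2 * ((∫ t in t₁..t₂, (β * (y t 1 * yt t 1) + γ * (yx t 1 * ytx t 1)))
        + ∫ t in t₁..t₂, (yt t 1 ^ 2 + ytx t 1 ^ 2)) := by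
    rw [← intervalIntegral.integral_add hc hd, ← intervalIntegral.integral_const_mul]
    refine integral_congr fun t ht => ?_
    rw [Set.uIcc_of_le h12] at ht
    obtain ⟨e1, e2⟩ := hbc1 t (hsub ht)
    have e3 : yxxx t 1 = β * y t 1 + yt t 1 := by linarith
    have e4 : yxx t 1 = -(γ * yx t 1 + ytx t 1) := by linarith
    simp only [e3, e4]
    ring
  rw [hE, hE]
  linarith

/-- Proposition 3.7: estimate of the boundary terms `∫ y(t,1)² + ∫ (∂_x y(t,1))²`
via the energy, through the auxiliary stationary variational problem. -/
theorem stmt16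
    (T β γ K : ℝ) (a a' : ℝ → ℝ)
    (y yt ytt yx yxx yxxx yxxxx ytx ytxx : ℝ → ℝ → ℝ) (E : ℝ → ℝ)
    (hT : 0 < T) (hβ : 0 ≤ β) (hγ : 0 ≤ γ)
    -- degeneracy context
    (ha_cont : ContinuousOn a (Set.Icc 0 1))
    (ha0 : a 0 = 0)
    (ha_pos : ∀ x ∈ Set.Ioc (0:ℝ) 1, 0 < a x)
    (ha_deriv : ∀ x ∈ Set.Ioc (0:ℝ) 1, HasDerivAt a (a' x) x)
    (ha'_cont : ContinuousOn a' (Set.Ioc 0 1))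
    (hK0 : 0 < K) (hK2 : K < 2)
    (hKbound : ∀ x ∈ Set.Ioc (0:ℝ) 1, x * |a' x| ≤ K * a x)
    -- smoothness: all the relevant partial derivatives exist ...
    (hyt : ∀ t ∈ Set.Icc (0:ℝ) T, ∀ x ∈ Set.Icc (0:ℝ) 1,
      HasDerivAt (fun s => y s x) (yt t x) t)
    (hytt : ∀ t ∈ Set.Icc (0:ℝ) T, ∀ x ∈ Set.Icc (0:ℝ) 1,
      HasDerivAt (fun s => yt s x) (ytt t x) t)
    (hyx : ∀ t ∈ Set.Icc (0:ℝ) T, ∀ x ∈ Set.Icc (0:ℝ) 1,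
      HasDerivAt (fun ξ => y t ξ) (yx t x) x)
    (hyxx : ∀ t ∈ Set.Icc (0:ℝ) T, ∀ x ∈ Set.Icc (0:ℝ) 1,
      HasDerivAt (fun ξ => yx t ξ) (yxx t x) x)
    (hyxxx : ∀ t ∈ Set.Icc (0:ℝ) T, ∀ x ∈ Set.Icc (0:ℝ) 1,
      HasDerivAt (fun ξ => yxx t ξ) (yxxx t x) x)
    (hyxxxx : ∀ t ∈ Set.Icc (0:ℝ) T, ∀ x ∈ Set.Icc (0:ℝ) 1,
      HasDerivAt (fun ξ => yxxx t ξ) (yxxxx t x) x)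
    (hytx : ∀ t ∈ Set.Icc (0:ℝ) T, ∀ x ∈ Set.Icc (0:ℝ) 1,
      HasDerivAt (fun ξ => yt t ξ) (ytx t x) x)
    (hytxx : ∀ t ∈ Set.Icc (0:ℝ) T, ∀ x ∈ Set.Icc (0:ℝ) 1,
      HasDerivAt (fun ξ => ytx t ξ) (ytxx t x) x)
    -- ... and are continuous on the space-time domain
    (hcont : ∀ f ∈ [y, yt, ytt, yx, yxx, yxxx, yxxxx, ytx, ytxx],
      ContinuousOn (fun p : ℝ × ℝ => f p.1 p.2) (Set.Icc (0:ℝ) T ×ˢ Set.Icc 0 1))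
    -- the degenerate beam equation
    (heq : ∀ t ∈ Set.Icc (0:ℝ) T, ∀ x ∈ Set.Ioc (0:ℝ) 1,
      ytt t x + a x * yxxxx t x = 0)
    -- clamped conditions at 0, dissipative conditions at 1
    (hbc0 : ∀ t ∈ Set.Icc (0:ℝ) T, y t 0 = 0 ∧ yx t 0 = 0)
    (hbc1 : ∀ t ∈ Set.Icc (0:ℝ) T,
      β * y t 1 - yxxx t 1 + yt t 1 = 0 ∧ γ * yx t 1 + yxx t 1 + ytx t 1 = 0)
    -- weighted Hardy inequality with constant C_HP
    (CHP : ℝ) (hCHP : 0 < CHP)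
    (hHardy : ∀ v v' : ℝ → ℝ,
      (∀ x ∈ Set.Icc (0:ℝ) 1, HasDerivAt v (v' x) x) →
      ContinuousOn v' (Set.Icc 0 1) → v 0 = 0 →
      (∫ x in (0:ℝ)..1, (v x) ^ 2 / a x) ≤ CHP * ∫ x in (0:ℝ)..1, (v' x) ^ 2)
    (hE : ∀ t, E t = (1/2) * (∫ x in (0:ℝ)..1, ((yt t x) ^ 2 / a x + (yxx t x) ^ 2))
        + (β/2) * (y t 1) ^ 2 + (γ/2) * (yx t 1) ^ 2)
    -- the constants of Proposition 3.7
    (Cβ Cγ ν : ℝ)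
    (hCβ : Cβ = if 0 < β then min 2 (2/β) else 2)
    (hCγ : Cγ = if 0 < γ then min 2 (2/γ) else 2)
    (hν : ν = if 1 < β then
        (if 1 < γ then β * γ / (2 * (β + γ)) else β / (2 * (β + 1)))
      else
        (if 1 < γ then γ / (2 * (1 + γ)) else 1/4))
    (δ Cδ : ℝ) (hδ0 : 0 < δ) (hδν : δ < ν)
    (hCδ : Cδ = if 1 < β then
        (if 1 < γ then 1 - 2 * δ * (1/β + 1/γ) else 1 - 2 * δ * (1/β + 1))
      else
        (if 1 < γ then 1 - 2 * δ * (1 + 1/γ) else 1 - 4 * δ)) :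
    ∀ s : ℝ, 0 < s → s < T →
      (∫ t in s..T, (y t 1) ^ 2) + (∫ t in s..T, (yx t 1) ^ 2)
        ≤ (2 * δ / Cδ) * (∫ t in s..T, E t)
          + (1 / Cδ) * (2 * (1 + (4 * CHP + 1) * (Cβ + Cγ)) + (1/δ) * (8 * CHP + 3))
              * E s := by
  intro s hs0 hsT
  simp only [List.forall_mem_cons, List.not_mem_nil, IsEmpty.forall_iff, implies_true,
    and_true] at hcont
  obtain ⟨cy, cyt, cytt, cyx, cyxx, cyxxx, cyxxxx, cytx, cytxx⟩ := hcont
  have one_mem : (1:ℝ) ∈ Set.Icc (0:ℝ) 1 := ⟨zero_le_one, le_rfl⟩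
  have zero_mem : (0:ℝ) ∈ Set.Icc (0:ℝ) 1 := ⟨le_rfl, zero_le_one⟩
  have hyx_t := hasDerivAt_mixed zero_lt_one cy cyt cytx
    (fun t ht => hyt t (Set.Ioo_subset_Icc_self ht)) hyx hytx
  have hyxx_t := hasDerivAt_mixed zero_lt_one cyx cytx cytxx hyx_t hyxx hytxx
  have hyt0 : ∀ t ∈ Set.Icc (0:ℝ) T, yt t 0 = 0 := fun t ht =>
    (uniqueDiffOn_Icc hT t ht).eq_deriv _ (hyt t ht 0 zero_mem).hasDerivWithinAt
      ((hasDerivWithinAt_const t _ 0).congr_of_mem (fun z hz => (hbc0 z hz).1) ht)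
  have hytx0 : ∀ t ∈ Set.Ioo (0:ℝ) T, ytx t 0 = 0 := fun t ht =>
    (uniqueDiffOn_Icc hT t (Set.Ioo_subset_Icc_self ht)).eq_deriv _
      (hyx_t t ht 0 zero_mem).hasDerivWithinAt
      ((hasDerivWithinAt_const t _ 0).congr_of_mem (fun z hz => (hbc0 z hz).2)
        (Set.Ioo_subset_Icc_self ht))
  have hb := continuousOn_sq_div hK2 ha_cont ha_pos ha_deriv hKbound
  have hyta : ∀ t ∈ Set.Icc (0:ℝ) T,
      IntervalIntegrable (fun x => yt t x ^ 2 / a x) volume 0 1 := fun t ht =>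
    intervalIntegrable_sq_div ha_cont ha_pos hb (hytx t ht) (continuousOn_slice_snd cytx ht)
      (hyt0 t ht)
  have hdiss := energy_sub_eq ha_pos hyt hytt hyxxx hyxxxx hytx hytxx hyx_t hyxx_t cy cyt cyx
    cyxx cyxxxx cytx cytxx heq hyt0 hytx0 hbc1 hyta hE
  obtain ⟨pβ, lβ, kβ⟩ := two_mul_sq_le_of_eq_ite hCβ hβ
  obtain ⟨pγ, lγ, kγ⟩ := two_mul_sq_le_of_eq_ite hCγ hγ
  obtain ⟨hCδ_eq, hCδ_pos⟩ := coupling_constant_eq hCβ hCγ hν hδν hCδ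
  have hkin : ∀ t, 0 ≤ ∫ x in (0:ℝ)..1, yt t x ^ 2 / a x := fun t =>
    integral_nonneg zero_le_one fun x hx => by
      rcases hx.1.eq_or_lt with rfl | h0
      · simp [ha0]
      · exact div_nonneg (sq_nonneg _) (ha_pos x ⟨h0, hx.2⟩).le
  have hE' : ∀ t ∈ Set.Icc (0:ℝ) T, E t = (1/2) * ((∫ x in (0:ℝ)..1, yt t x ^ 2 / a x)
      + ∫ x in (0:ℝ)..1, yxx t x ^ 2) + (β/2) * (y t 1) ^ 2 + (γ/2) * (yx t 1) ^ 2 := by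
    intro t ht
    have h : IntervalIntegrable (fun x => yxx t x ^ 2) volume 0 1 :=
      ((continuousOn_slice_snd cyxx ht).pow 2).intervalIntegrable_of_Icc zero_le_one
    rw [hE, intervalIntegral.integral_add (hyta t ht) h]
  have hbdry : ∀ t ∈ Set.Icc (0:ℝ) T, (∫ x in (0:ℝ)..1, yt t x ^ 2 / a x) ≤ 2 * E t ∧
      (y t 1) ^ 2 + (yx t 1) ^ 2 ≤ (Cβ + Cγ) * E t := by
    intro t ht
    obtain ⟨z1, z2⟩ := sq_le_integral_sq_of_clamped (hyx t ht) (hyxx t ht)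
      (continuousOn_slice_snd cyxx ht) (hbc0 t ht).1 (hbc0 t ht).2
    have k1 := kβ _ _ z1
    have k2 := kγ _ _ z2
    have n1 : 0 ≤ β * (y t 1) ^ 2 := by positivity
    have n2 : 0 ≤ γ * (yx t 1) ^ 2 := by positivity
    have n3 := (sq_nonneg _).trans z1
    have e := hE' t ht
    have hk := hkin t
    refine ⟨by linarith, ?_⟩
    have m1 : Cβ * ((∫ x in (0:ℝ)..1, yxx t x ^ 2) + β * (y t 1) ^ 2) ≤ Cβ * (2 * E t) :=
      mul_le_mul_of_nonneg_left (by linarith) pβ.le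
    have m2 : Cγ * ((∫ x in (0:ℝ)..1, yxx t x ^ 2) + γ * (yx t 1) ^ 2) ≤ Cγ * (2 * E t) :=
      mul_le_mul_of_nonneg_left (by linarith) pγ.le
    linarith
  have hEpos : ∀ t ∈ Set.Icc (0:ℝ) T, 0 ≤ E t := fun t ht => by
    linarith [(hbdry t ht).1, hkin t]
  have hEanti : ∀ t₁ t₂ : ℝ, 0 ≤ t₁ → t₁ ≤ t₂ → t₂ ≤ T → E t₂ ≤ E t₁ := by
    intro t₁ t₂ h1 h12 h2
    have h := hdiss t₁ t₂ h1 h12 h2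
    have h0 : 0 ≤ ∫ t in t₁..t₂, ((yt t 1) ^ 2 + (ytx t 1) ^ 2) :=
      integral_nonneg h12 fun t _ => by positivity
    linarith
  have hsT' := hsT.le
  have hsub : Set.Icc s T ⊆ Set.Icc 0 T := Set.Icc_subset_Icc_left hs0.le
  have hsubo : Set.Ioo s T ⊆ Set.Ioo 0 T := Set.Ioo_subset_Ioo_left hs0.le
  have hrect : Set.Icc s T ×ˢ Set.Icc (0:ℝ) 1 ⊆ Set.Icc 0 T ×ˢ Set.Icc (0:ℝ) 1 :=
    Set.prod_mono hsub subset_rfl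
  have hs_mem : s ∈ Set.Icc (0:ℝ) T := ⟨hs0.le, hsT'⟩
  have hT_mem : T ∈ Set.Icc (0:ℝ) T := ⟨hT.le, le_rfl⟩
  have sy := (continuousOn_slice_fst cy one_mem).mono hsub
  have syt := (continuousOn_slice_fst cyt one_mem).mono hsub
  have syx := (continuousOn_slice_fst cyx one_mem).mono hsub
  have sytx := (continuousOn_slice_fst cytx one_mem).mono hsub
  obtain ⟨A₁, A₂, B₁, B₂, hcubic⟩ := exists_cubic_coefficients hβ hγ
  set G : ℝ → ℝ → ℝ := fun t x =>
    yt t x * ((A₁ * yt t 1 + A₂ * ytx t 1) + (B₁ * yt t 1 + B₂ * ytx t 1) * x) * (x ^ 2 / a x)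
      - yxxxx t x * ((A₁ * y t 1 + A₂ * yx t 1) * x ^ 2 + (B₁ * y t 1 + B₂ * yx t 1) * x ^ 3)
    with hGdef
  set Φ : ℝ → ℝ := fun t => ∫ x in (0:ℝ)..1,
    yt t x * ((A₁ * y t 1 + A₂ * yx t 1) + (B₁ * y t 1 + B₂ * yx t 1) * x) * (x ^ 2 / a x)
    with hΦdef
  have lift : ∀ {g : ℝ → ℝ}, ContinuousOn g (Set.Icc s T) →
      ContinuousOn (fun p : ℝ × ℝ => g p.1) (Set.Icc s T ×ˢ Set.Icc (0:ℝ) 1) := fun hg =>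
    hg.comp continuous_fst.continuousOn fun _ hp => hp.1
  have hbp : ContinuousOn (fun p : ℝ × ℝ => p.2 ^ 2 / a p.2) (Set.Icc s T ×ˢ Set.Icc (0:ℝ) 1) :=
    hb.comp continuous_snd.continuousOn fun _ hp => hp.2
  have hGc : ContinuousOn (fun p : ℝ × ℝ => G p.1 p.2) (Set.Icc s T ×ˢ Set.Icc 0 1) := by
    have hpq : ∀ {g h : ℝ → ℝ}, ContinuousOn g (Set.Icc s T) → ContinuousOn h (Set.Icc s T) →
        ∀ c₁ c₂ : ℝ, ContinuousOn (fun p : ℝ × ℝ => c₁ * g p.1 + c₂ * h p.1)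
          (Set.Icc s T ×ˢ Set.Icc (0:ℝ) 1) := fun hg hh c₁ c₂ =>
      ((lift hg).const_mul c₁).add ((lift hh).const_mul c₂)
    have hx : ContinuousOn (fun p : ℝ × ℝ => p.2) (Set.Icc s T ×ˢ Set.Icc (0:ℝ) 1) :=
      continuous_snd.continuousOn
    exact (((cyt.mono hrect).mul ((hpq syt sytx A₁ A₂).add
      ((hpq syt sytx B₁ B₂).mul hx))).mul hbp).sub ((cyxxxx.mono hrect).mul
        (((hpq sy syx A₁ A₂).mul (hx.pow 2)).add ((hpq sy syx B₁ B₂).mul (hx.pow 3))))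
  have hΦint : ∀ t ∈ Set.Icc (0:ℝ) T, ∀ p q : ℝ,
      IntervalIntegrable (fun x => yt t x * (p + q * x) * (x ^ 2 / a x)) volume 0 1 :=
    fun t ht p q => (((continuousOn_slice_snd cyt ht).mul (by fun_prop)).mul
      hb).intervalIntegrable_of_Icc zero_le_one
  have hΦ : Φ T - Φ s = ∫ t in s..T, ∫ x in (0:ℝ)..1, G t x := by
    refine integral_sub_eq_integral_integral
      (F := fun t x => yt t x * ((A₁ * y t 1 + A₂ * yx t 1) + (B₁ * y t 1 + B₂ * yx t 1) * x)
        * (x ^ 2 / a x)) hsT' zero_le_one ?_ ?_ hGc (hΦint s hs_mem _ _) (hΦint T hT_mem _ _)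
    · intro x hx
      have w := (continuousOn_slice_fst cyt (Set.Ioc_subset_Icc_self hx)).mono hsub
      fun_prop
    · intro t ht x hx
      have hto := hsubo ht
      have htc := Set.Ioo_subset_Icc_self hto
      have d1 := hyt t htc 1 one_mem
      have d2 := hyx_t t hto 1 one_mem
      have h := ((hytt t htc x (Set.Ioc_subset_Icc_self hx)).mul
        (((d1.const_mul A₁).add (d2.const_mul A₂)).add
          (((d1.const_mul B₁).add (d2.const_mul B₂)).mul_const x))).mul_const (x ^ 2 / a x)
      refine h.congr_deriv ?_
      have hatt : ytt t x = -(a x * yxxxx t x) := by linarith [heq t htc x hx]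
      have ha := (ha_pos x hx).ne'
      simp only [hGdef, hatt, Pi.add_apply]
      field_simp
      ring
  have hGint : ∀ t ∈ Set.Icc s T, (∫ x in (0:ℝ)..1, G t x)
      = (∫ x in (0:ℝ)..1, yt t x * ((A₁ * yt t 1 + A₂ * ytx t 1)
          + (B₁ * yt t 1 + B₂ * ytx t 1) * x) * (x ^ 2 / a x))
        - ((y t 1) ^ 2 + (yx t 1) ^ 2
          + ((A₁ * y t 1 + A₂ * yx t 1) + (B₁ * y t 1 + B₂ * yx t 1)) * yt t 1
          + (2 * (A₁ * y t 1 + A₂ * yx t 1) + 3 * (B₁ * y t 1 + B₂ * yx t 1)) * ytx t 1) := by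
    intro t ht
    have htc := hsub ht
    obtain ⟨e1, e2⟩ := hcubic (y t 1) (yx t 1)
    set p := A₁ * y t 1 + A₂ * yx t 1
    set q := B₁ * y t 1 + B₂ * yx t 1
    have hi : IntervalIntegrable (fun x => yxxxx t x * (p * x ^ 2 + q * x ^ 3)) volume 0 1 :=
      ((continuousOn_slice_snd cyxxxx htc).mul (by fun_prop)).intervalIntegrable_of_Icc zero_le_one
    rw [hGdef, intervalIntegral.integral_sub (hΦint t htc _ _) hi]
    congr 1
    rw [integral_eq_sub_of_hasDerivAt (f := fun x => yxxx t x * (p * x ^ 2 + q * x ^ 3)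
      - yxx t x * (2 * p * x + 3 * q * x ^ 2) + yx t x * (2 * p + 6 * q * x) - y t x * (6 * q))
      ?_ hi]
    · obtain ⟨b1, b2⟩ := hbc1 t htc
      have e3 : yxxx t 1 = β * y t 1 + yt t 1 := by linarith
      have e4 : yxx t 1 = -(γ * yx t 1 + ytx t 1) := by linarith
      simp only [(hbc0 t htc).1, (hbc0 t htc).2, e3, e4]
      linear_combination y t 1 * e1 + yx t 1 * e2
    · intro x hx
      rw [Set.uIcc_of_le zero_le_one] at hx
      have v0 : HasDerivAt (fun x => p * x ^ 2 + q * x ^ 3) (2 * p * x + 3 * q * x ^ 2) x :=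
        (((hasDerivAt_pow 2 x).const_mul p).add ((hasDerivAt_pow 3 x).const_mul q)).congr_deriv
          (by push_cast; ring)
      have v1 : HasDerivAt (fun x => 2 * p * x + 3 * q * x ^ 2) (2 * p + 6 * q * x) x :=
        (((hasDerivAt_id x).const_mul (2 * p)).add
          ((hasDerivAt_pow 2 x).const_mul (3 * q))).congr_deriv (by push_cast; ring)
      have v2 : HasDerivAt (fun x => 2 * p + 6 * q * x) (6 * q) x :=
        (((hasDerivAt_id x).const_mul (6 * q)).const_add (2 * p)).congr_deriv (by ring)
      have h := ((((hyxxxx t htc x hx).mul v0).sub ((hyxxx t htc x hx).mul v1)).add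
        ((hyxx t htc x hx).mul v2)).sub ((hyx t htc x hx).mul_const (6 * q))
      exact h.congr_deriv (by ring)
  have hS4 : Cβ + Cγ ≤ 4 := by linarith
  have hS0 : 0 < Cβ + Cγ := by linarith
  obtain ⟨S, hS⟩ : ∃ S, S = Cβ + Cγ := ⟨_, rfl⟩
  rw [← hS] at hS4 hS0 hbdry hCδ_eq ⊢
  have hΦle : ∀ t ∈ Set.Icc (0:ℝ) T, |Φ t| ≤ (1 + CHP * S) * E t := by
    intro t ht
    obtain ⟨e1, e2⟩ := hcubic (y t 1) (yx t 1)
    obtain ⟨c1, -⟩ := cubic_bounds hβ hγ hCβ hCγ e1 e2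
    rw [← hS] at c1
    have h := abs_integral_mul_cubic_div_le (κ := 1 / 2) (A₁ * y t 1 + A₂ * yx t 1)
      (B₁ * y t 1 + B₂ * yx t 1) hCHP (by norm_num) ha_pos hb hHardy
      (continuousOn_slice_snd cyt ht) (hyta t ht)
    obtain ⟨k1, k2⟩ := hbdry t ht
    have c2 : 4 * (A₁ * y t 1 + A₂ * yx t 1) ^ 2
        + 12 * (A₁ * y t 1 + A₂ * yx t 1) * (B₁ * y t 1 + B₂ * yx t 1)
        + 12 * (B₁ * y t 1 + B₂ * yx t 1) ^ 2 ≤ 4 * (S * E t) := by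
      have m1 : S / 2 * ((y t 1) ^ 2 + (yx t 1) ^ 2) ≤ 2 * ((y t 1) ^ 2 + (yx t 1) ^ 2) :=
        mul_le_mul_of_nonneg_right (by linarith) (by positivity)
      linarith [mul_nonneg hS0.le (hEpos t ht)]
    have c3 := mul_le_mul_of_nonneg_left c2 (show 0 ≤ CHP / (8 * (1 / 2)) by positivity)
    calc |Φ t| ≤ _ := h
      _ ≤ 1 / 2 * (2 * E t) + CHP / (8 * (1 / 2)) * (4 * (S * E t)) := by linarith
      _ = _ := by ring
  have hpt : ∀ t ∈ Set.Icc s T, Cδ * ((y t 1) ^ 2 + (yx t 1) ^ 2) ≤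
      2 * δ * E t + (CHP + 1) / (4 * δ) * ((yt t 1) ^ 2 + (ytx t 1) ^ 2)
        - ∫ x in (0:ℝ)..1, G t x := by
    intro t ht
    have htc := hsub ht
    have hg := hGint t ht
    obtain ⟨e1, e2⟩ := hcubic (y t 1) (yx t 1)
    obtain ⟨-, c1⟩ := cubic_bounds hβ hγ hCβ hCγ e1 e2
    obtain ⟨f1, f2⟩ := hcubic (yt t 1) (ytx t 1)
    obtain ⟨d1, -⟩ := cubic_bounds hβ hγ hCβ hCγ f1 f2
    rw [← hS] at c1 d1
    have h := (le_abs_self _).trans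
      (abs_integral_mul_cubic_div_le (κ := δ) (A₁ * yt t 1 + A₂ * ytx t 1)
      (B₁ * yt t 1 + B₂ * ytx t 1) hCHP hδ0 ha_pos hb hHardy
      (continuousOn_slice_snd cyt htc) (hyta t htc))
    have k1 := mul_le_mul_of_nonneg_left (hbdry t htc).1 hδ0.le
    have hR : 0 ≤ (yt t 1) ^ 2 + (ytx t 1) ^ 2 := by positivity
    have d2 := d1.trans (mul_le_mul_of_nonneg_right (show S / 2 ≤ 2 by linarith) hR)
    have d3 := mul_le_mul_of_nonneg_left d2 (show 0 ≤ CHP / (8 * δ) by positivity)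
    have c2 := mul_le_mul_of_nonneg_left c1 hδ0.le
    generalize (A₁ * y t 1 + A₂ * yx t 1) + (B₁ * y t 1 + B₂ * yx t 1) = v at hg c2
    generalize 2 * (A₁ * y t 1 + A₂ * yx t 1) + 3 * (B₁ * y t 1 + B₂ * yx t 1) = w at hg c2
    have young : 0 ≤ δ * (v ^ 2 + w ^ 2) + 1 / (4 * δ) * ((yt t 1) ^ 2 + (ytx t 1) ^ 2)
        + (v * yt t 1 + w * ytx t 1) := by
      have : δ * (v ^ 2 + w ^ 2) + 1 / (4 * δ) * ((yt t 1) ^ 2 + (ytx t 1) ^ 2)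
          + (v * yt t 1 + w * ytx t 1)
          = ((2 * δ * v + yt t 1) ^ 2 + (2 * δ * w + ytx t 1) ^ 2) / (4 * δ) := by
        field_simp; ring
      rw [this]; positivity
    have hc : (CHP + 1) / (4 * δ) * ((yt t 1) ^ 2 + (ytx t 1) ^ 2)
        = CHP / (8 * δ) * (2 * ((yt t 1) ^ 2 + (ytx t 1) ^ 2))
          + 1 / (4 * δ) * ((yt t 1) ^ 2 + (ytx t 1) ^ 2) := by
      field_simp; ring
    rw [hCδ_eq, hc]
    linarith
  have iE : IntervalIntegrable E volume s T := by
    refine AntitoneOn.intervalIntegrable ?_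
    rw [Set.uIcc_of_le hsT']
    exact fun t₁ h₁ t₂ h₂ h => hEanti t₁ t₂ (hsub h₁).1 h h₂.2
  have iR : IntervalIntegrable (fun t => (yt t 1) ^ 2 + (ytx t 1) ^ 2) volume s T :=
    ContinuousOn.intervalIntegrable_of_Icc hsT' (by fun_prop)
  have iG : IntervalIntegrable (fun t => ∫ x in (0:ℝ)..1, G t x) volume s T :=
    (continuousOn_integral_snd hsT' zero_le_one hGc).intervalIntegrable_of_Icc hsT'
  have iy : IntervalIntegrable (fun t => (y t 1) ^ 2) volume s T :=
    ContinuousOn.intervalIntegrable_of_Icc hsT' (by fun_prop)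
  have iyx : IntervalIntegrable (fun t => (yx t 1) ^ 2) volume s T :=
    ContinuousOn.intervalIntegrable_of_Icc hsT' (by fun_prop)
  have hmono := integral_mono_on hsT' ((iy.add iyx).const_mul Cδ)
    (((iE.const_mul (2 * δ)).add (iR.const_mul ((CHP + 1) / (4 * δ)))).sub iG) hpt
  rw [intervalIntegral.integral_const_mul, intervalIntegral.integral_add iy iyx,
    intervalIntegral.integral_sub ((iE.const_mul _).add (iR.const_mul _)) iG,
    intervalIntegral.integral_add (iE.const_mul _) (iR.const_mul _),
    intervalIntegral.integral_const_mul, intervalIntegral.integral_const_mul, ← hΦ] at hmono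
  have hRle : (∫ t in s..T, ((yt t 1) ^ 2 + (ytx t 1) ^ 2)) ≤ E s := by
    linarith [hdiss s T hs0.le hsT' le_rfl, hEpos T hT_mem]
  have hR1 := mul_le_mul_of_nonneg_left hRle (show 0 ≤ (CHP + 1) / (4 * δ) by positivity)
  have hΦ1 : -(Φ T - Φ s) ≤ 2 * ((1 + CHP * S) * E s) := by
    have h1 := neg_abs_le (Φ T)
    have h2 := le_abs_self (Φ s)
    have h3 := hΦle T hT_mem
    have h4 := hΦle s hs_mem
    have h5 := mul_le_mul_of_nonneg_left (hEanti s T hs0.le hsT' le_rfl)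
      (show 0 ≤ 1 + CHP * S by positivity)
    linarith
  have hconst : 2 * (1 + CHP * S) + (CHP + 1) / (4 * δ)
      ≤ 2 * (1 + (4 * CHP + 1) * S) + (1 / δ) * (8 * CHP + 3) := by
    have h1 : (1 / δ) * (8 * CHP + 3) - (CHP + 1) / (4 * δ) = (31 * CHP + 11) / (4 * δ) := by
      field_simp; ring
    have h2 : 0 ≤ (31 * CHP + 11) / (4 * δ) := by positivity
    have h3 : 0 ≤ CHP * S := by positivity
    linarith
  have hfin := mul_le_mul_of_nonneg_right hconst (hEpos s hs_mem)
  have htarget : (2 * δ / Cδ) * (∫ t in s..T, E t)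
      + (1 / Cδ) * (2 * (1 + (4 * CHP + 1) * S) + (1/δ) * (8 * CHP + 3)) * E s
      = (2 * δ * (∫ t in s..T, E t)
        + (2 * (1 + (4 * CHP + 1) * S) + (1/δ) * (8 * CHP + 3)) * E s) / Cδ := by ring
  rw [htarget, le_div_iff₀ hCδ_pos]
  linarith
end

section
/- Let a be as in the degeneracy context with K := sup_{x∈(0,1]} x|a'(x)|/a(x) < 2, let C_HP > 0 satisfy the weighted Hardy inequality, let β ≥ 0, γ ≥ 0, and let y be a smooth classical solution of the degenerate beam problem on [0,∞)×[0,1] with energy E(t). Define θ := max{4/a(1) + K·C_HP, 1 + K/4}, ρ := max{2, K/4 + 1 + 1/a(1)}, C_β := min{2,2/β} if β > 0 else 2, C_γ := min{2,2/γ} if γ > 0 else 2, ν := βγ/(2(β+γ)) if β > 1, γ > 1; γ/(2(1+γ)) if β ∈ [0,1], γ > 1; β/(2(β+1)) if β > 1, γ ∈ [0,1]; 1/4 if β, γ ∈ [0,1]; and for δ ∈ (0,ν), C_δ := 1 − 2δ(1/β + 1/γ) if β > 1, γ > 1; 1 − 2δ(1 + 1/γ) if β ∈ [0,1], γ > 1;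 1 − 2δ(1/β + 1) if β > 1, γ ∈ [0,1]; 1 − 4δ if β, γ ∈ [0,1]. Let ε₀ ∈ (0, 2−K], set S := Kβ/2 + K/4 + β + ε₀β/2 + β + 1 + 2γ² + ε₀γ/2, C₁ := (2/C_δ)·S, C₃ := (1/C_δ)·(2 + 2(4C_HP+1)(C_β + C_γ) + (1/δ)(8C_HP + 3))·S, C₂ := 4θ + ρ + (C_γ/2)(2 − K/2) + C₃, and suppose δ satisfies δ·C₁ < ε₀; set M := C₂/(ε₀ − δC₁). Then for all t > 0, E(t) ≤ E(0)·e^{1 − t/M}. -/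
open MeasureTheory intervalIntegral

section

open Set Filter Topology

/-- A function that is continuous and bounded on `(0, 1]` is integrable there. -/
lemma intervalIntegrable_of_continuousOn_Ioc_of_bound {f : ℝ → ℝ} {C : ℝ}
    (hf : ContinuousOn f (Ioc 0 1)) (hC : ∀ x ∈ Ioc (0:ℝ) 1, |f x| ≤ C) :
    IntervalIntegrable f volume 0 1 := by
  rw [intervalIntegrable_iff_integrableOn_Ioc_of_le zero_le_one]
  exact IntegrableOn.of_bound (by simp) (hf.aestronglyMeasurable measurableSet_Ioc) C
    ((ae_restrict_iff' measurableSet_Ioc).2 (ae_of_all _ hC))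

/-- Differentiation under the integral sign on `[0, ∞) × (0, 1]` with a bounded derivative. -/
lemma hasDerivWithinAt_integral_of_bound {f f' : ℝ → ℝ → ℝ} {t C : ℝ} (ht : 0 ≤ t)
    (hint : ∀ s, 0 ≤ s → IntervalIntegrable (f s) volume 0 1)
    (hd : ∀ s ∈ Icc 0 (t + 1), ∀ x ∈ Ioc (0:ℝ) 1,
      HasDerivWithinAt (fun r => f r x) (f' s x) (Ici 0) s)
    (hb : ∀ s ∈ Icc 0 (t + 1), ∀ x ∈ Ioc (0:ℝ) 1, |f' s x| ≤ C) :
    HasDerivWithinAt (fun s => ∫ x in (0:ℝ)..1, f s x) (∫ x in (0:ℝ)..1, f' t x) (Ici 0) t := by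
  have htI : t ∈ Icc 0 (t + 1) := ⟨ht, by linarith⟩
  rw [hasDerivWithinAt_iff_tendsto_slope]
  have hev : ∀ᶠ s in 𝓝[Ici 0 \ {t}] t, s ∈ Icc 0 (t + 1) ∧ s ≠ t := by
    have h1 : ∀ᶠ s in 𝓝[Ici 0 \ {t}] t, s < t + 1 :=
      nhdsWithin_le_nhds (Iio_mem_nhds (by linarith))
    filter_upwards [h1, self_mem_nhdsWithin] with s hs hs'
    exact ⟨⟨hs'.1, hs.le⟩, hs'.2⟩
  have hslope : ∀ᶠ s in 𝓝[Ici 0 \ {t}] t,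
      (∫ x in (0:ℝ)..1, slope (fun r => f r x) t s)
        = slope (fun s => ∫ x in (0:ℝ)..1, f s x) t s := by
    filter_upwards [hev] with s hs
    simp only [slope_def_field]
    rw [intervalIntegral.integral_div, intervalIntegral.integral_sub (hint s hs.1.1) (hint t ht)]
  refine Tendsto.congr' hslope ?_
  refine intervalIntegral.tendsto_integral_filter_of_dominated_convergence (fun _ => C) ?_ ?_
    (by simp) ?_
  · filter_upwards [hev] with s hs
    have : (fun x => slope (fun r => f r x) t s) = fun x => (f s x - f t x) / (s - t) := by
      ext x; rw [slope_def_field]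
    rw [this, uIoc_of_le zero_le_one]
    exact (((hint s hs.1.1).sub (hint t ht)).div_const _).1.aestronglyMeasurable
  · filter_upwards [hev] with s hs
    refine ae_of_all _ fun x hx => ?_
    rw [uIoc_of_le zero_le_one] at hx
    have hmv := Convex.norm_image_sub_le_of_norm_hasDerivWithin_le
      (fun r hr => (hd r hr x hx).mono Icc_subset_Ici_self) (fun r hr => hb r hr x hx)
      (convex_Icc 0 (t + 1)) htI hs.1
    rw [slope_def_field, norm_div, div_le_iff₀ (norm_pos_iff.2 (sub_ne_zero.2 hs.2))]
    exact hmv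
  · refine ae_of_all _ fun x hx => ?_
    rw [uIoc_of_le zero_le_one] at hx
    exact hasDerivWithinAt_iff_tendsto_slope.1 (hd t htI x hx)

/-- If `∂ₜ F = G` and `∂ₓ G = L` is continuous, then `∂ₜ ∂ₓ F = L`. -/
lemma hasDerivWithinAt_of_mixed {F G H L : ℝ → ℝ → ℝ}
    (hG : ∀ t ∈ Ici (0:ℝ), ∀ x ∈ Icc (0:ℝ) 1,
      HasDerivWithinAt (fun s => F s x) (G t x) (Ici 0) t)
    (hH : ∀ t ∈ Ici (0:ℝ), ∀ x ∈ Icc (0:ℝ) 1, HasDerivAt (fun ξ => F t ξ) (H t x) x)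
    (hL : ∀ t ∈ Ici (0:ℝ), ∀ x ∈ Icc (0:ℝ) 1, HasDerivAt (fun ξ => G t ξ) (L t x) x)
    (hLc : ContinuousOn (fun p : ℝ × ℝ => L p.1 p.2) (Ici (0:ℝ) ×ˢ Icc 0 1))
    {t x : ℝ} (ht : t ∈ Ici (0:ℝ)) (hx : x ∈ Icc (0:ℝ) 1) :
    HasDerivWithinAt (fun s => H s x) (L t x) (Ici 0) t := by
  rw [hasDerivWithinAt_iff_isLittleO, Asymptotics.isLittleO_iff]
  intro ε hε
  obtain ⟨η, hη, hLη⟩ := Metric.continuousWithinAt_iff.1 (hLc (t, x) ⟨ht, hx⟩) ε hε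
  filter_upwards [self_mem_nhdsWithin, nhdsWithin_le_nhds (Metric.ball_mem_nhds t hη)]
    with s hs hsη
  set c := L t x
  have hnear : ∀ ξ ∈ Icc (0:ℝ) 1 ∩ Metric.ball x η,
      |(F s ξ - F t ξ - (s - t) * c * ξ) - (F s x - F t x - (s - t) * c * x)|
        ≤ ε * |s - t| * |ξ - x| := by
    intro ξ hξ
    have hspace : ∀ r ∈ Ici (0:ℝ) ∩ Metric.ball t η,
        ‖G r ξ - G r x - c * (ξ - x)‖ ≤ ε * |ξ - x| := by
      intro r hr
      have h := Convex.norm_image_sub_le_of_norm_hasDerivWithin_le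
        (f := fun z => G r z - c * z) (f' := fun z => L r z - c) (C := ε)
        (s := Icc (0:ℝ) 1 ∩ Metric.ball x η) (x := x) (y := ξ)
        (fun z hz => by
          simpa using ((hL r hr.1 z hz.1).fun_sub ((hasDerivAt_id z).const_mul c)).hasDerivWithinAt)
        (fun z hz => by
          have := hLη (x := (r, z)) ⟨hr.1, hz.1⟩ (by
            rw [Prod.dist_eq]; exact max_lt hr.2 hz.2)
          rw [Real.dist_eq] at this
          exact this.le)
        ((convex_Icc 0 1).inter (convex_ball x η)) ⟨hx, Metric.mem_ball_self hη⟩ hξ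
      have e : G r ξ - G r x - c * (ξ - x) = (G r ξ - c * ξ) - (G r x - c * x) := by ring
      rw [e]; exact h
    have h := Convex.norm_image_sub_le_of_norm_hasDerivWithin_le
      (f := fun r => F r ξ - F r x - c * (ξ - x) * r)
      (f' := fun r => G r ξ - G r x - c * (ξ - x)) (C := ε * |ξ - x|)
      (s := Ici (0:ℝ) ∩ Metric.ball t η) (x := t) (y := s)
      (fun r hr => by
        have := (((hG r hr.1 ξ hξ.1).fun_sub (hG r hr.1 x hx)).fun_sub
          ((hasDerivAt_id r).const_mul (c * (ξ - x))).hasDerivWithinAt).mono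
            (inter_subset_left (t := Metric.ball t η))
        simpa using this)
      hspace ((convex_Ici 0).inter (convex_ball t η)) ⟨ht, Metric.mem_ball_self hη⟩ ⟨hs, hsη⟩
    rw [Real.norm_eq_abs, Real.norm_eq_abs] at h
    calc _ = |F s ξ - F s x - c * (ξ - x) * s - (F t ξ - F t x - c * (ξ - x) * t)| := by
          congr 1; ring
      _ ≤ _ := h
      _ = _ := by ring
  have hder : HasDerivWithinAt (fun ξ => F s ξ - F t ξ - (s - t) * c * ξ)
      (H s x - H t x - (s - t) * c) (Icc 0 1) x := by
    simpa using (((hH s hs x hx).fun_sub (hH t ht x hx)).fun_sub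
      ((hasDerivAt_id x).const_mul ((s - t) * c))).hasDerivWithinAt
  have : (𝓝[Icc (0:ℝ) 1 \ {x}] x).NeBot := by
    have := uniqueDiffWithinAt_iff_accPt.1 (uniqueDiffOn_Icc (zero_lt_one' ℝ) x hx)
    rwa [accPt_principal_iff_nhdsWithin] at this
  refine le_of_tendsto (hasDerivWithinAt_iff_tendsto_slope.1 hder).norm ?_
  filter_upwards [self_mem_nhdsWithin, nhdsWithin_le_nhds (Metric.ball_mem_nhds x hη)]
    with ξ hξ hξη
  rw [slope_def_field, norm_div, div_le_iff₀ (norm_pos_iff.2 (sub_ne_zero.2 hξ.2))]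
  exact hnear ξ ⟨hξ.1, hξη⟩

/-- One-dimensional Poincaré (trace) inequality for functions vanishing at the left endpoint. -/
lemma sq_le_integral_deriv_sq {v v' : ℝ → ℝ}
    (hv : ∀ x ∈ Icc (0:ℝ) 1, HasDerivAt v (v' x) x) (hv' : ContinuousOn v' (Icc 0 1))
    (h0 : v 0 = 0) {x : ℝ} (hx : x ∈ Icc (0:ℝ) 1) :
    v x ^ 2 ≤ ∫ ξ in (0:ℝ)..1, v' ξ ^ 2 := by
  have hsub : Icc 0 x ⊆ Icc (0:ℝ) 1 := Icc_subset_Icc_right hx.2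
  have hcx : ContinuousOn v' (uIcc 0 x) := by rw [uIcc_of_le hx.1]; exact hv'.mono hsub
  have hc1 : ContinuousOn v' (uIcc x 1) := by
    rw [uIcc_of_le hx.2]; exact hv'.mono (Icc_subset_Icc_left hx.1)
  have hftc : ∫ ξ in (0:ℝ)..x, v' ξ = v x := by
    rw [integral_eq_sub_of_hasDerivAt (fun ξ hξ => hv ξ (hsub (by rwa [uIcc_of_le hx.1] at hξ)))
      hcx.intervalIntegrable, h0, sub_zero]
  have hsq : 0 ≤ ∫ ξ in (0:ℝ)..x, (v' ξ - v x) ^ 2 :=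
    integral_nonneg hx.1 fun ξ _ => sq_nonneg _
  have hexp : ∫ ξ in (0:ℝ)..x, (v' ξ - v x) ^ 2
      = (∫ ξ in (0:ℝ)..x, v' ξ ^ 2) - 2 * v x * v x + x * v x ^ 2 := by
    have e : ∀ ξ, (v' ξ - v x) ^ 2 = v' ξ ^ 2 - 2 * v x * v' ξ + v x ^ 2 := fun ξ => by ring
    simp_rw [e]
    rw [intervalIntegral.integral_add, intervalIntegral.integral_sub,
      intervalIntegral.integral_const_mul, hftc]
    · simp
    · exact (hcx.pow 2).intervalIntegrable
    · exact (hcx.const_mul _).intervalIntegrable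
    · exact ((hcx.pow 2).sub (hcx.const_mul _)).intervalIntegrable
    · simp
  have hsplit : (∫ ξ in (0:ℝ)..x, v' ξ ^ 2) + ∫ ξ in x..1, v' ξ ^ 2 = ∫ ξ in (0:ℝ)..1, v' ξ ^ 2 :=
    integral_add_adjacent_intervals (hcx.pow 2).intervalIntegrable
      (hc1.pow 2).intervalIntegrable
  have hrest : 0 ≤ ∫ ξ in x..1, v' ξ ^ 2 := integral_nonneg hx.2 fun ξ _ => sq_nonneg _
  nlinarith [mul_nonneg (sub_nonneg.2 hx.2) (sq_nonneg (v x))]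

lemma integral_sq_le_integral_deriv_sq {v v' : ℝ → ℝ}
    (hv : ∀ x ∈ Icc (0:ℝ) 1, HasDerivAt v (v' x) x) (hv' : ContinuousOn v' (Icc 0 1))
    (h0 : v 0 = 0) :
    ∫ x in (0:ℝ)..1, v x ^ 2 ≤ ∫ x in (0:ℝ)..1, v' x ^ 2 := by
  have hc : ContinuousOn v (uIcc 0 1) := by
    rw [uIcc_of_le zero_le_one]; exact fun x hx => (hv x hx).continuousAt.continuousWithinAt
  calc _ ≤ ∫ _ in (0:ℝ)..1, ∫ x in (0:ℝ)..1, v' x ^ 2 :=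
        integral_mono_on zero_le_one (hc.pow 2).intervalIntegrable (by simp)
          fun x hx => sq_le_integral_deriv_sq hv hv' h0 hx
    _ = _ := by simp

/-- Exponential decay from a dissipation inequality for an auxiliary functional `V` whose
variation is controlled by the nonincreasing quantity `E`. -/
lemma exp_decay_of_dissipation {E V V' : ℝ → ℝ} {κ C : ℝ} (hκ : 0 < κ) (hC : 0 < C)
    (hE0 : ∀ t, 0 ≤ t → 0 ≤ E t) (hE : AntitoneOn E (Ici 0))
    (hV : ∀ t, 0 ≤ t → HasDerivWithinAt V (V' t) (Ici 0) t)
    (hV' : ∀ t, 0 ≤ t → V' t ≤ -κ * E t)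
    (hVC : ∀ s t, 0 ≤ s → s ≤ t → V s - V t ≤ C * E s) {t : ℝ} (ht : 0 ≤ t) :
    E t ≤ E 0 * Real.exp (1 - t / (C / κ)) := by
  set M := C / κ with hM
  have hM0 : 0 < M := div_pos hC hκ
  have hMκ : M * κ = C := div_mul_cancel₀ C hκ.ne'
  have hE00 := hE0 0 le_rfl
  rcases lt_or_ge t M with htM | htM
  · have h1 : E t ≤ E 0 := hE self_mem_Ici ht ht
    have h2 : 1 ≤ Real.exp (1 - t / M) :=
      Real.one_le_exp (sub_nonneg.2 ((div_le_one hM0).2 htM.le))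
    nlinarith
  set s := t - M
  have hs : 0 ≤ s := sub_nonneg.2 htM
  have hst : s ≤ t := by simp [s, hM0.le]
  have hVc : ContinuousOn V (Ici 0) := fun r hr => (hV r hr).continuousWithinAt
  have hlow : C * E t ≤ V s - V t := by
    have hanti : AntitoneOn (fun r => V r + κ * E t * r) (Icc s t) := by
      have hsub : Icc s t ⊆ Ici 0 := fun r hr => hs.trans hr.1
      refine antitoneOn_of_hasDerivWithinAt_nonpos (convex_Icc s t)
        (f' := fun r => V' r + κ * E t) ?_ ?_ ?_
      · exact (hVc.mono hsub).add (by fun_prop)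
      · intro r hr
        have hr' := interior_subset hr
        simpa using ((hV r (hsub hr')).mono (interior_subset.trans hsub)).fun_add
          ((hasDerivAt_id r).const_mul (κ * E t)).hasDerivWithinAt
      · intro r hr
        have hr' := interior_subset hr
        have := hV' r (hsub hr')
        have := hE (hsub hr') ht hr'.2
        nlinarith
    have := hanti (left_mem_Icc.2 hst) (right_mem_Icc.2 hst) hst
    simp only at this
    have e : t = s + M := by simp [s]
    have e2 : κ * E t * t = κ * E t * s + C * E t := by
      rw [← hMκ]; nth_rewrite 2 [e]; ring
    linarith
  have hup : (V s - V t) * Real.exp (s / M) ≤ (V 0 - V t) * Real.exp (0 / M) := by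
    have hsub : Icc 0 s ⊆ Ici 0 := Icc_subset_Ici_self
    have hd : ∀ r : ℝ, HasDerivAt (fun r => Real.exp (r / M)) (Real.exp (r / M) * (1 / M)) r :=
      fun r => ((hasDerivAt_id r).div_const M).exp
    have hanti : AntitoneOn (fun r => (V r - V t) * Real.exp (r / M)) (Icc 0 s) := by
      refine antitoneOn_of_hasDerivWithinAt_nonpos (convex_Icc 0 s)
        (f' := fun r => V' r * Real.exp (r / M) + (V r - V t) * (Real.exp (r / M) * (1 / M)))
        ?_ ?_ ?_
      · exact ((hVc.mono hsub).sub continuousOn_const).mul (by fun_prop)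
      · intro r hr
        have hr' := interior_subset hr
        exact (((hV r (hsub hr')).mono (interior_subset.trans hsub)).sub_const _).mul
          (hd r).hasDerivWithinAt
      · intro r hr
        have hr' := interior_subset hr
        have h1 := hV' r hr'.1
        have h2 := hVC r t hr'.1 (hr'.2.trans hst)
        have h3 : (V r - V t) * (1 / M) ≤ κ * E r := by
          rw [mul_one_div, div_le_iff₀ hM0]
          calc _ ≤ _ := h2
            _ = _ := by rw [← hMκ]; ring
        have : (V' r + (V r - V t) * (1 / M)) * Real.exp (r / M) ≤ 0 :=
          mul_nonpos_of_nonpos_of_nonneg (by linarith) (Real.exp_pos _).le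
        linarith
    exact hanti (left_mem_Icc.2 hs) (right_mem_Icc.2 hs) hs
  have h0 := hVC 0 t le_rfl ht
  have e : Real.exp (1 - t / M) = (Real.exp (s / M))⁻¹ := by
    rw [← Real.exp_neg]; congr 1; simp only [s]; field_simp; ring
  rw [e, ← div_eq_mul_inv, le_div_iff₀ (Real.exp_pos _)]
  have hep := Real.exp_pos (s / M)
  simp only [zero_div, Real.exp_zero, mul_one] at hup
  have : C * (E t * Real.exp (s / M)) ≤ C * E 0 := by nlinarith
  exact le_of_mul_le_mul_left this hC

lemma integral_eq_sub_of_hasDerivAt_Icc {g g' : ℝ → ℝ}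
    (hg : ∀ x ∈ Icc (0:ℝ) 1, HasDerivAt g (g' x) x) (hg' : ContinuousOn g' (Icc 0 1)) :
    ∫ x in (0:ℝ)..1, g' x = g 1 - g 0 := by
  rw [← uIcc_of_le zero_le_one] at hg hg'
  exact integral_eq_sub_of_hasDerivAt hg hg'.intervalIntegrable

lemma intervalIntegrable_of_continuousOn_Icc {g : ℝ → ℝ} (hg : ContinuousOn g (Icc 0 1)) :
    IntervalIntegrable g volume 0 1 := by
  rw [← uIcc_of_le zero_le_one] at hg
  exact hg.intervalIntegrable

lemma abs_le_mul_of_abs_deriv_le {v v' : ℝ → ℝ} {C : ℝ}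
    (hv : ∀ x ∈ Icc (0:ℝ) 1, HasDerivAt v (v' x) x) (h0 : v 0 = 0)
    (hC : ∀ x ∈ Icc (0:ℝ) 1, |v' x| ≤ C) {x : ℝ} (hx : x ∈ Icc (0:ℝ) 1) :
    |v x| ≤ C * x := by
  simpa [h0, abs_of_nonneg hx.1] using Convex.norm_image_sub_le_of_norm_hasDerivWithin_le
    (fun z hz => (hv z hz).hasDerivWithinAt) hC (convex_Icc 0 1) (left_mem_Icc.2 zero_le_one) hx

/-- `w₁, …, w₄` are the successive derivatives of `w` on `[0, 1]`, and `w` is clamped at `0`. -/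
structure IsClampedChain (w w₁ w₂ w₃ w₄ : ℝ → ℝ) : Prop where
  d₀ : ∀ x ∈ Icc (0:ℝ) 1, HasDerivAt w (w₁ x) x
  d₁ : ∀ x ∈ Icc (0:ℝ) 1, HasDerivAt w₁ (w₂ x) x
  d₂ : ∀ x ∈ Icc (0:ℝ) 1, HasDerivAt w₂ (w₃ x) x
  d₃ : ∀ x ∈ Icc (0:ℝ) 1, HasDerivAt w₃ (w₄ x) x
  c₄ : ContinuousOn w₄ (Icc 0 1)
  zero : w 0 = 0
  zero₁ : w₁ 0 = 0

namespace IsClampedChain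

variable {w w₁ w₂ w₃ w₄ : ℝ → ℝ}

lemma c₀ (h : IsClampedChain w w₁ w₂ w₃ w₄) : ContinuousOn w (Icc 0 1) :=
  fun x hx => (h.d₀ x hx).continuousAt.continuousWithinAt

lemma c₁ (h : IsClampedChain w w₁ w₂ w₃ w₄) : ContinuousOn w₁ (Icc 0 1) :=
  fun x hx => (h.d₁ x hx).continuousAt.continuousWithinAt

lemma c₂ (h : IsClampedChain w w₁ w₂ w₃ w₄) : ContinuousOn w₂ (Icc 0 1) :=
  fun x hx => (h.d₂ x hx).continuousAt.continuousWithinAt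

lemma integral_fourth_mul_self (h : IsClampedChain w w₁ w₂ w₃ w₄) :
    ∫ x in (0:ℝ)..1, w₄ x * w x = w 1 * w₃ 1 - w₁ 1 * w₂ 1 + ∫ x in (0:ℝ)..1, w₂ x ^ 2 := by
  have c₀ := h.c₀; have c₂ := h.c₂; have c₄ := h.c₄
  have key := integral_eq_sub_of_hasDerivAt_Icc (g := fun x => w x * w₃ x - w₁ x * w₂ x)
    (g' := fun x => w₄ x * w x - w₂ x ^ 2)
    (fun x hx => (((h.d₀ x hx).fun_mul (h.d₃ x hx)).fun_sub
      ((h.d₁ x hx).fun_mul (h.d₂ x hx))).congr_deriv (by ring))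
    ((c₄.mul c₀).sub (c₂.pow 2))
  rw [intervalIntegral.integral_sub (intervalIntegrable_of_continuousOn_Icc (by fun_prop))
    (intervalIntegrable_of_continuousOn_Icc (by fun_prop))] at key
  simp only [h.zero, h.zero₁] at key
  linarith

lemma integral_fourth_mul_id_mul_deriv (h : IsClampedChain w w₁ w₂ w₃ w₄) :
    ∫ x in (0:ℝ)..1, w₄ x * (x * w₁ x)
      = w₁ 1 * w₃ 1 - w₁ 1 * w₂ 1 - w₂ 1 ^ 2 / 2 + 3 / 2 * ∫ x in (0:ℝ)..1, w₂ x ^ 2 := by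
  have c₁ := h.c₁; have c₂ := h.c₂; have c₄ := h.c₄
  have c : ContinuousOn (fun x => w₄ x * (x * w₁ x)) (Icc 0 1) := c₄.mul (continuousOn_id.mul c₁)
  have key := integral_eq_sub_of_hasDerivAt_Icc
    (g := fun x => x * w₁ x * w₃ x - w₁ x * w₂ x - x * w₂ x ^ 2 / 2)
    (g' := fun x => w₄ x * (x * w₁ x) - 3 / 2 * w₂ x ^ 2)
    (fun x hx => ((((hasDerivAt_id' x).fun_mul (h.d₁ x hx)).fun_mul (h.d₃ x hx)).fun_sub
      ((h.d₁ x hx).fun_mul (h.d₂ x hx)) |>.fun_sub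
      (((hasDerivAt_id' x).fun_mul ((h.d₂ x hx).fun_pow 2)).div_const 2)).congr_deriv
        (by push_cast; ring))
    (c.sub (continuousOn_const.mul (c₂.pow 2)))
  rw [intervalIntegral.integral_sub (intervalIntegrable_of_continuousOn_Icc c)
    (intervalIntegrable_of_continuousOn_Icc (by fun_prop)),
    intervalIntegral.integral_const_mul] at key
  simp only [h.zero₁] at key
  linarith

lemma integral_fourth_mul_sq (h : IsClampedChain w w₁ w₂ w₃ w₄) :
    ∫ x in (0:ℝ)..1, w₄ x * x ^ 2 = w₃ 1 - 2 * w₂ 1 + 2 * w₁ 1 := by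
  have key := integral_eq_sub_of_hasDerivAt_Icc
    (g := fun x => x ^ 2 * w₃ x - 2 * (x * w₂ x) + 2 * w₁ x) (g' := fun x => w₄ x * x ^ 2)
    (fun x hx => (((((hasDerivAt_id' x).fun_pow 2).fun_mul (h.d₃ x hx)).fun_sub
      (((hasDerivAt_id' x).fun_mul (h.d₂ x hx)).const_mul 2)).fun_add
      ((h.d₁ x hx).const_mul 2)).congr_deriv (by push_cast; ring))
    (h.c₄.mul (by fun_prop))
  simp only [h.zero₁] at key
  linarith

lemma integral_fourth_mul_cube (h : IsClampedChain w w₁ w₂ w₃ w₄) :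
    ∫ x in (0:ℝ)..1, w₄ x * x ^ 3 = w₃ 1 - 3 * w₂ 1 + 6 * w₁ 1 - 6 * w 1 := by
  have key := integral_eq_sub_of_hasDerivAt_Icc
    (g := fun x => x ^ 3 * w₃ x - 3 * (x ^ 2 * w₂ x) + 6 * (x * w₁ x) - 6 * w x)
    (g' := fun x => w₄ x * x ^ 3)
    (fun x hx => ((((((hasDerivAt_id' x).fun_pow 3).fun_mul (h.d₃ x hx)).fun_sub
      ((((hasDerivAt_id' x).fun_pow 2).fun_mul (h.d₂ x hx)).const_mul 3)).fun_add
      (((hasDerivAt_id' x).fun_mul (h.d₁ x hx)).const_mul 6)).fun_sub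
      ((h.d₀ x hx).const_mul 6)).congr_deriv (by push_cast; ring))
    (h.c₄.mul (by fun_prop))
  simp only [h.zero] at key
  linarith

end IsClampedChain

/-- A weight on `(0, 1]`, possibly vanishing at `0`, of degeneracy exponent `K < 2`. -/
structure IsDegenerateWeight (K : ℝ) (a a' : ℝ → ℝ) : Prop where
  pos : ∀ x ∈ Ioc (0:ℝ) 1, 0 < a x
  deriv : ∀ x ∈ Ioc (0:ℝ) 1, HasDerivAt a (a' x) x
  deriv_cont : ContinuousOn a' (Ioc 0 1)
  lt_two : K < 2
  bound : ∀ x ∈ Ioc (0:ℝ) 1, x * |a' x| ≤ K * a x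

namespace IsDegenerateWeight

variable {K : ℝ} {a a' : ℝ → ℝ}

lemma one_pos (h : IsDegenerateWeight K a a') : 0 < a 1 := h.pos 1 (by simp)

lemma cont (h : IsDegenerateWeight K a a') : ContinuousOn a (Ioc 0 1) :=
  fun x hx => (h.deriv x hx).continuousAt.continuousWithinAt

lemma ne (h : IsDegenerateWeight K a a') : ∀ x ∈ Ioc (0:ℝ) 1, a x ≠ 0 :=
  fun x hx => (h.pos x hx).ne'

lemma sq_div_le (h : IsDegenerateWeight K a a') {x : ℝ} (hx : x ∈ Ioc (0:ℝ) 1) :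
    x ^ 2 / a x ≤ 1 / a 1 := by
  have hsub : Icc x 1 ⊆ Ioc 0 1 := fun z hz => ⟨hx.1.trans_le hz.1, hz.2⟩
  have hmono : MonotoneOn (fun x => x ^ 2 / a x) (Icc x 1) := by
    refine monotoneOn_of_hasDerivWithinAt_nonneg (convex_Icc x 1)
      (f' := fun z => (2 * z * a z - z ^ 2 * a' z) / a z ^ 2)
      (ContinuousOn.div (by fun_prop) (h.cont.mono hsub) fun z hz => h.ne z (hsub hz)) ?_ ?_
    · intro z hz
      have hz' := hsub (interior_subset hz)
      exact ((((hasDerivAt_id' z).fun_pow 2).fun_div (h.deriv z hz') (h.ne z hz')).congr_deriv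
        (by push_cast; ring)).hasDerivWithinAt
    · intro z hz
      have hz' := hsub (interior_subset hz)
      have h1 := h.bound z hz'
      have h2 := h.pos z hz'
      have h3 : z * a' z ≤ 2 * a z :=
        (mul_le_mul_of_nonneg_left (le_abs_self _) hz'.1.le).trans
          (h1.trans (mul_le_mul_of_nonneg_right h.lt_two.le h2.le))
      exact div_nonneg (by nlinarith [mul_nonneg hz'.1.le (sub_nonneg.2 h3)]) (sq_nonneg _)
  simpa using hmono (left_mem_Icc.2 hx.2) (right_mem_Icc.2 hx.2) hx.2

lemma integral_sq_div_nonneg (h : IsDegenerateWeight K a a') (v : ℝ → ℝ) :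
    0 ≤ ∫ x in (0:ℝ)..1, v x ^ 2 / a x := by
  rw [integral_of_le zero_le_one]
  exact setIntegral_nonneg measurableSet_Ioc fun x hx => div_nonneg (sq_nonneg _) (h.pos x hx).le

lemma abs_mul_div_le (h : IsDegenerateWeight K a a') {x u v Cu Cv : ℝ} (hx : x ∈ Ioc (0:ℝ) 1)
    (hu : |u| ≤ Cu * x) (hv : |v| ≤ Cv * x) : |u * v / a x| ≤ Cu * Cv * (1 / a 1) := by
  have hCu : 0 ≤ Cu := nonneg_of_mul_nonneg_left ((abs_nonneg u).trans hu) hx.1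
  have hCv : 0 ≤ Cv := nonneg_of_mul_nonneg_left ((abs_nonneg v).trans hv) hx.1
  have ha := h.pos x hx
  rw [abs_div, abs_mul, abs_of_pos ha]
  calc |u| * |v| / a x ≤ (Cu * x) * (Cv * x) / a x :=
        div_le_div_of_nonneg_right
          (mul_le_mul hu hv (abs_nonneg v) (mul_nonneg hCu hx.1.le)) ha.le
    _ = Cu * Cv * (x ^ 2 / a x) := by ring
    _ ≤ _ := mul_le_mul_of_nonneg_left (h.sq_div_le hx) (mul_nonneg hCu hCv)

lemma continuousOn_mul_div (h : IsDegenerateWeight K a a') {u v : ℝ → ℝ}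
    (hu : ContinuousOn u (Icc 0 1)) (hv : ContinuousOn v (Icc 0 1)) :
    ContinuousOn (fun x => u x * v x / a x) (Ioc 0 1) :=
  ((hu.mul hv).mono Ioc_subset_Icc_self).div h.cont h.ne

lemma intervalIntegrable_mul_div (h : IsDegenerateWeight K a a') {u v : ℝ → ℝ} {Cu Cv : ℝ}
    (hu : ContinuousOn u (Icc 0 1)) (hv : ContinuousOn v (Icc 0 1))
    (hu' : ∀ x ∈ Icc (0:ℝ) 1, |u x| ≤ Cu * x) (hv' : ∀ x ∈ Icc (0:ℝ) 1, |v x| ≤ Cv * x) :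
    IntervalIntegrable (fun x => u x * v x / a x) volume 0 1 :=
  intervalIntegrable_of_continuousOn_Ioc_of_bound (h.continuousOn_mul_div hu hv) fun x hx =>
    h.abs_mul_div_le hx (hu' x (Ioc_subset_Icc_self hx)) (hv' x (Ioc_subset_Icc_self hx))

/-- Weighted Young inequality. -/
lemma two_mul_integral_mul_div_le (h : IsDegenerateWeight K a a') {u v : ℝ → ℝ} {Cu Cv η : ℝ}
    (hu : ContinuousOn u (Icc 0 1)) (hv : ContinuousOn v (Icc 0 1))
    (hu' : ∀ x ∈ Icc (0:ℝ) 1, |u x| ≤ Cu * x) (hv' : ∀ x ∈ Icc (0:ℝ) 1, |v x| ≤ Cv * x)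
    (hη : 0 < η) :
    |2 * ∫ x in (0:ℝ)..1, u x * v x / a x|
      ≤ η * (∫ x in (0:ℝ)..1, u x ^ 2 / a x) + 1 / η * ∫ x in (0:ℝ)..1, v x ^ 2 / a x := by
  have iuv := h.intervalIntegrable_mul_div hu hv hu' hv'
  have iuu : IntervalIntegrable (fun x => u x ^ 2 / a x) volume 0 1 := by
    simpa only [sq] using h.intervalIntegrable_mul_div hu hu hu' hu'
  have ivv : IntervalIntegrable (fun x => v x ^ 2 / a x) volume 0 1 := by
    simpa only [sq] using h.intervalIntegrable_mul_div hv hv hv' hv'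
  have hpt : ∀ x ∈ Ioo (0:ℝ) 1,
      2 * (u x * v x / a x) ≤ η * (u x ^ 2 / a x) + 1 / η * (v x ^ 2 / a x) ∧
      -(η * (u x ^ 2 / a x) + 1 / η * (v x ^ 2 / a x)) ≤ 2 * (u x * v x / a x) := by
    intro x hx
    have ha := h.pos x (Ioo_subset_Ioc_self hx)
    have e1 : η * (u x ^ 2 / a x) + 1 / η * (v x ^ 2 / a x) - 2 * (u x * v x / a x)
        = (η * u x - v x) ^ 2 / (η * a x) := by field_simp; ring
    have e2 : η * (u x ^ 2 / a x) + 1 / η * (v x ^ 2 / a x) + 2 * (u x * v x / a x)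
        = (η * u x + v x) ^ 2 / (η * a x) := by field_simp; ring
    have p1 : 0 ≤ (η * u x - v x) ^ 2 / (η * a x) := by positivity
    have p2 : 0 ≤ (η * u x + v x) ^ 2 / (η * a x) := by positivity
    constructor <;> linarith
  have isum := (iuu.const_mul η).add (ivv.const_mul (1 / η))
  rw [abs_le, ← intervalIntegral.integral_const_mul, ← intervalIntegral.integral_const_mul,
    ← intervalIntegral.integral_const_mul, ← intervalIntegral.integral_add (iuu.const_mul η)
      (ivv.const_mul (1 / η)), ← intervalIntegral.integral_neg]
  exact ⟨integral_mono_on_of_le_Ioo zero_le_one isum.neg (iuv.const_mul 2) fun x hx => (hpt x hx).2,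
    integral_mono_on_of_le_Ioo zero_le_one (iuv.const_mul 2) isum fun x hx => (hpt x hx).1⟩

lemma integral_mul_id_mul_deriv_div_le (h : IsDegenerateWeight K a a') {v v' : ℝ → ℝ} {C : ℝ}
    (hv : ∀ x ∈ Icc (0:ℝ) 1, HasDerivAt v (v' x) x) (hv' : ContinuousOn v' (Icc 0 1))
    (h0 : v 0 = 0) (hC : ∀ x ∈ Icc (0:ℝ) 1, |v' x| ≤ C) :
    ∫ x in (0:ℝ)..1, v x * (x * v' x) / a x
      ≤ v 1 ^ 2 / (2 * a 1) - (1 - K) / 2 * ∫ x in (0:ℝ)..1, v x ^ 2 / a x := by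
  have hvc : ContinuousOn v (Icc 0 1) := fun x hx => (hv x hx).continuousAt.continuousWithinAt
  have hvl : ∀ x ∈ Icc (0:ℝ) 1, |v x| ≤ C * x := fun x hx => abs_le_mul_of_abs_deriv_le hv h0 hC hx
  have hxv : ∀ x ∈ Icc (0:ℝ) 1, |x * v' x| ≤ C * x := fun x hx => by
    rw [abs_mul, abs_of_nonneg hx.1, mul_comm]
    exact mul_le_mul_of_nonneg_right (hC x hx) hx.1
  have hxvc : ContinuousOn (fun x => x * v' x) (Icc 0 1) := continuousOn_id.mul hv'
  have i1 := h.intervalIntegrable_mul_div hvc hxvc hvl hxv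
  have i2 := h.intervalIntegrable_mul_div hvc hvc hvl hvl
  simp only [← sq] at i2
  have i3 : IntervalIntegrable (fun x => x * a' x / a x * (v x ^ 2 / a x)) volume 0 1 := by
    refine intervalIntegrable_of_continuousOn_Ioc_of_bound (C := K * (C * C * (1 / a 1))) ?_ ?_
    · simp only [sq]
      exact ((continuousOn_id.mul h.deriv_cont).div h.cont h.ne).mul
        (h.continuousOn_mul_div hvc hvc)
    · intro x hx
      have hx' := Ioc_subset_Icc_self hx
      have ha := h.pos x hx
      have hk : |x * a' x / a x| ≤ K := by
        rw [abs_div, abs_mul, abs_of_pos hx.1, abs_of_pos ha, div_le_iff₀ ha]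
        exact h.bound x hx
      rw [abs_mul, sq]
      exact mul_le_mul hk (h.abs_mul_div_le hx (hvl x hx') (hvl x hx')) (abs_nonneg _)
        ((abs_nonneg _).trans hk)
  set g : ℝ → ℝ := fun x => x * v x ^ 2 / (2 * a x)
  set g' : ℝ → ℝ := fun x => v x * (x * v' x) / a x + 1 / 2 * (v x ^ 2 / a x)
    - 1 / 2 * (x * a' x / a x * (v x ^ 2 / a x)) with hg'
  have hder : ∀ x ∈ Ioc (0:ℝ) 1, HasDerivAt g (g' x) x := by
    intro x hx
    have ha := h.ne x hx
    refine (((hasDerivAt_id' x).fun_mul ((hv x (Ioc_subset_Icc_self hx)).fun_pow 2)).fun_div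
      ((h.deriv x hx).const_mul 2) (by simpa using ha)).congr_deriv ?_
    simp only [hg']
    field_simp
    ring
  have hg0 : g 0 = 0 := by simp [g]
  have hgl : ∀ x ∈ Icc (0:ℝ) 1, |g x| ≤ C * C * (1 / a 1) * x := by
    intro x hx
    rcases hx.1.eq_or_lt with rfl | hx0
    · simp [hg0]
    have hb := h.abs_mul_div_le ⟨hx0, hx.2⟩ (hvl x hx) (hvl x hx)
    have e : g x = v x * v x / a x * (x / 2) := by
      simp only [g]; have := h.ne x ⟨hx0, hx.2⟩; field_simp
    rw [e, abs_mul, abs_of_pos (half_pos hx0)]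
    have := (abs_nonneg _).trans hb
    nlinarith
  have hgc : ContinuousOn g (Icc 0 1) := by
    intro x hx
    rcases hx.1.eq_or_lt with rfl | hx0
    · rw [ContinuousWithinAt, hg0]
      refine squeeze_zero_norm' (a := fun x => C * C * (1 / a 1) * x) ?_ ?_
      · filter_upwards [self_mem_nhdsWithin] with z hz using hgl z hz
      · have : ContinuousWithinAt (fun x : ℝ => C * C * (1 / a 1) * x) (Icc 0 1) 0 := by fun_prop
        simpa [ContinuousWithinAt] using this
    · exact (hder x ⟨hx0, hx.2⟩).continuousAt.continuousWithinAt
  have ig' : IntervalIntegrable g' volume 0 1 :=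
    (i1.add (i2.const_mul (1 / 2))).sub (i3.const_mul (1 / 2))
  have hftc := integral_eq_sub_of_hasDerivAt_of_le zero_le_one hgc
    (fun x hx => hder x (Ioo_subset_Ioc_self hx)) ig'
  have hle : ∫ x in (0:ℝ)..1, (v x * (x * v' x) / a x + (1 - K) / 2 * (v x ^ 2 / a x))
      ≤ ∫ x in (0:ℝ)..1, g' x := by
    refine integral_mono_on_of_le_Ioo zero_le_one (i1.add (i2.const_mul _)) ig' fun x hx => ?_
    have hx' := Ioo_subset_Ioc_self hx
    have ha := h.pos x hx'
    have hk : x * a' x / a x ≤ K := by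
      rw [div_le_iff₀ ha]
      exact (mul_le_mul_of_nonneg_left (le_abs_self _) hx.1.le).trans (h.bound x hx')
    have hq : 0 ≤ v x ^ 2 / a x := by positivity
    simp only [hg']
    nlinarith [mul_le_mul_of_nonneg_right hk hq]
  rw [intervalIntegral.integral_add i1 (i2.const_mul _), intervalIntegral.integral_const_mul,
    hftc, hg0] at hle
  simp only [g, one_mul, sub_zero] at hle
  linarith

end IsDegenerateWeight

/-- Coefficients of the cubic `p x² + q x³` solving the static beam problem with boundary data
`l, m` depend linearly on the data. -/
lemma exists_static_coeff {β γ : ℝ} (hβ : 0 ≤ β) (hγ : 0 ≤ γ) :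
    ∃ p₁ p₂ q₁ q₂ : ℝ, ∀ l m : ℝ,
      β * ((p₁ * l + p₂ * m) + (q₁ * l + q₂ * m)) - 6 * (q₁ * l + q₂ * m) = l ∧
      γ * (2 * (p₁ * l + p₂ * m) + 3 * (q₁ * l + q₂ * m))
        + (2 * (p₁ * l + p₂ * m) + 6 * (q₁ * l + q₂ * m)) = m := by
  have hD : β * γ + 4 * β + 12 * γ + 12 ≠ 0 := by positivity
  refine ⟨(3 * γ + 6) / (β * γ + 4 * β + 12 * γ + 12), (6 - β) / (β * γ + 4 * β + 12 * γ + 12),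
    -(2 * γ + 2) / (β * γ + 4 * β + 12 * γ + 12), β / (β * γ + 4 * β + 12 * γ + 12),
    fun l m => ⟨?_, ?_⟩⟩ <;> field_simp <;> ring

lemma static_energy_le {β γ p q l m : ℝ} (hβ : 0 ≤ β) (hγ : 0 ≤ γ)
    (h₁ : β * (p + q) - 6 * q = l) (h₂ : γ * (2 * p + 3 * q) + (2 * p + 6 * q) = m) :
    4 * p ^ 2 + 12 * p * q + 12 * q ^ 2
        ≤ (1 / max 1 β + 1 / max 1 γ) * (l ^ 2 + m ^ 2) ∧
      (p + q) ^ 2 + (2 * p + 3 * q) ^ 2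
        ≤ 2 * (1 / max 1 β + 1 / max 1 γ) * (l ^ 2 + m ^ 2) := by
  obtain ⟨z, hz⟩ : ∃ z, z = p + q := ⟨_, rfl⟩
  obtain ⟨w, hw⟩ : ∃ w, w = 2 * p + 3 * q := ⟨_, rfl⟩
  obtain ⟨N, hN⟩ : ∃ N, N = 4 * p ^ 2 + 12 * p * q + 12 * q ^ 2 := ⟨_, rfl⟩
  obtain ⟨T, hT⟩ : ∃ T, T = N + β * z ^ 2 + γ * w ^ 2 := ⟨_, rfl⟩
  have hzN : z ^ 2 ≤ N := by
    rw [hz, hN]; nlinarith [sq_nonneg (3 * p + 5 * q), sq_nonneg q]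
  have hwN : w ^ 2 ≤ N := by rw [hw, hN]; nlinarith [sq_nonneg q]
  have hβz := mul_nonneg hβ (sq_nonneg z)
  have hγw := mul_nonneg hγ (sq_nonneg w)
  have hTd : T = l * z + m * w := by rw [hT, ← h₁, ← h₂, hN, hz, hw]; ring
  have hbound : ∀ b s : ℝ, s ^ 2 ≤ T → b * s ^ 2 ≤ T → s ^ 2 ≤ 1 / max 1 b * T := by
    intro b s hs hbs
    have hm : 0 < max 1 b := lt_max_of_lt_left one_pos
    rw [div_mul_eq_mul_div, one_mul, le_div_iff₀ hm, mul_comm]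
    rcases max_choice 1 b with e | e <;> rw [e] <;> linarith
  have hz' := hbound β z (by linarith) (by nlinarith [sq_nonneg w])
  have hw' := hbound γ w (by linarith) (by nlinarith [sq_nonneg z])
  obtain ⟨κ, hκ⟩ : ∃ κ, κ = 1 / max 1 β + 1 / max 1 γ := ⟨_, rfl⟩
  have h1β : 1 / max 1 β ≤ 1 := (div_le_one (lt_max_of_lt_left one_pos)).2 (le_max_left _ _)
  have h1γ : 1 / max 1 γ ≤ 1 := (div_le_one (lt_max_of_lt_left one_pos)).2 (le_max_left _ _)
  have hκ2 : κ ≤ 2 := by linarith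
  have hκ0 : 0 ≤ κ := by rw [hκ]; positivity
  have hsum : z ^ 2 + w ^ 2 ≤ κ * T := by rw [hκ, add_mul]; exact add_le_add hz' hw'
  have hT0 : 0 ≤ T := by nlinarith [sq_nonneg z]
  have hlm : 0 ≤ l ^ 2 + m ^ 2 := by positivity
  have hTT : T * T ≤ κ * (l ^ 2 + m ^ 2) * T := by
    have hcs : T * T ≤ (l ^ 2 + m ^ 2) * (z ^ 2 + w ^ 2) := by
      rw [hTd]; nlinarith [sq_nonneg (l * w - m * z)]
    nlinarith [mul_le_mul_of_nonneg_left hsum hlm]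
  have hTle : T ≤ κ * (l ^ 2 + m ^ 2) := by
    rcases hT0.eq_or_lt with e | e
    · rw [← e]; positivity
    · exact le_of_mul_le_mul_right hTT e
  rw [← hκ, ← hN, ← hz, ← hw]
  exact ⟨by linarith, by nlinarith [mul_le_mul_of_nonneg_right hκ2 hT0]⟩

/-- Classical solutions of the degenerate beam problem with clamped end `0` and dissipative
boundary feedback at `1`. -/
structure IsBeamSolution (β γ : ℝ) (a : ℝ → ℝ)
    (y yt yx yxx yxxx yxxxx ytx ytxx : ℝ → ℝ → ℝ) : Prop where
  dt_y : ∀ t ∈ Ici (0:ℝ), ∀ x ∈ Icc (0:ℝ) 1, HasDerivAt (fun s => y s x) (yt t x) t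
  dt_yt : ∀ t ∈ Ici (0:ℝ), ∀ x ∈ Ioc (0:ℝ) 1,
    HasDerivAt (fun s => yt s x) (-(a x * yxxxx t x)) t
  dx_y : ∀ t ∈ Ici (0:ℝ), ∀ x ∈ Icc (0:ℝ) 1, HasDerivAt (fun ξ => y t ξ) (yx t x) x
  dx_yx : ∀ t ∈ Ici (0:ℝ), ∀ x ∈ Icc (0:ℝ) 1, HasDerivAt (fun ξ => yx t ξ) (yxx t x) x
  dx_yxx : ∀ t ∈ Ici (0:ℝ), ∀ x ∈ Icc (0:ℝ) 1, HasDerivAt (fun ξ => yxx t ξ) (yxxx t x) x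
  dx_yxxx : ∀ t ∈ Ici (0:ℝ), ∀ x ∈ Icc (0:ℝ) 1, HasDerivAt (fun ξ => yxxx t ξ) (yxxxx t x) x
  dx_yt : ∀ t ∈ Ici (0:ℝ), ∀ x ∈ Icc (0:ℝ) 1, HasDerivAt (fun ξ => yt t ξ) (ytx t x) x
  dx_ytx : ∀ t ∈ Ici (0:ℝ), ∀ x ∈ Icc (0:ℝ) 1, HasDerivAt (fun ξ => ytx t ξ) (ytxx t x) x
  cont : ∀ f ∈ [yt, yx, yxx, yxxxx, ytx, ytxx],
    ContinuousOn (fun p : ℝ × ℝ => f p.1 p.2) (Ici (0:ℝ) ×ˢ Icc 0 1)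
  clamped : ∀ t ∈ Ici (0:ℝ), y t 0 = 0 ∧ yx t 0 = 0
  feedback : ∀ t ∈ Ici (0:ℝ),
    yxxx t 1 = β * y t 1 + yt t 1 ∧ yxx t 1 = -(γ * yx t 1) - ytx t 1

/-- The energy of the degenerate beam. -/
noncomputable def beamEnergy (β γ : ℝ) (a : ℝ → ℝ) (y yt yx yxx : ℝ → ℝ → ℝ) (t : ℝ) : ℝ :=
  (1/2) * (∫ x in (0:ℝ)..1, ((yt t x) ^ 2 / a x + (yxx t x) ^ 2))
    + (β/2) * (y t 1) ^ 2 + (γ/2) * (yx t 1) ^ 2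

/-- Time-dependent multipliers that vanish linearly at `x = 0`, along with their time derivative,
locally uniformly in time. -/
structure IsBeamMultiplier (v vt : ℝ → ℝ → ℝ) : Prop where
  dt : ∀ t ∈ Ici (0:ℝ), ∀ x ∈ Icc (0:ℝ) 1,
    HasDerivWithinAt (fun s => v s x) (vt t x) (Ici 0) t
  cont : ∀ t ∈ Ici (0:ℝ), ContinuousOn (v t) (Icc 0 1)
  cont_dt : ∀ t ∈ Ici (0:ℝ), ContinuousOn (vt t) (Icc 0 1)
  lin : ∀ T, ∃ C, ∀ t ∈ Icc 0 T, ∀ x ∈ Icc (0:ℝ) 1, |v t x| ≤ C * x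
  lin_dt : ∀ T, ∃ C, ∀ t ∈ Icc 0 T, ∀ x ∈ Icc (0:ℝ) 1, |vt t x| ≤ C * x

lemma isBeamMultiplier_pow (k : ℕ) :
    IsBeamMultiplier (fun _ x => x ^ (k + 1)) (fun _ _ => 0) where
  dt t _ x _ := hasDerivWithinAt_const t _ _
  cont t _ := by fun_prop
  cont_dt t _ := by fun_prop
  lin T := ⟨1, fun t _ x hx => by
    rw [abs_of_nonneg (pow_nonneg hx.1 _), pow_succ]
    exact mul_le_mul_of_nonneg_right (pow_le_one₀ hx.1 hx.2) hx.1⟩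
  lin_dt T := ⟨0, fun t _ x _ => by simp⟩

lemma exists_bound_of_continuousOn_prod {f : ℝ → ℝ → ℝ}
    (hf : ContinuousOn (fun p : ℝ × ℝ => f p.1 p.2) (Ici (0:ℝ) ×ˢ Icc 0 1)) (T : ℝ) :
    ∃ C, ∀ t ∈ Icc 0 T, ∀ x ∈ Icc (0:ℝ) 1, |f t x| ≤ C := by
  obtain ⟨C, hC⟩ := (isCompact_Icc.prod isCompact_Icc).exists_bound_of_continuousOn
    (hf.mono (prod_mono_left (Icc_subset_Ici_self : Icc 0 T ⊆ Ici 0)))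
  exact ⟨C, fun t ht x hx => hC (t, x) ⟨ht, hx⟩⟩

lemma continuousOn_slice {f : ℝ → ℝ → ℝ}
    (hf : ContinuousOn (fun p : ℝ × ℝ => f p.1 p.2) (Ici (0:ℝ) ×ˢ Icc 0 1)) {t : ℝ}
    (ht : t ∈ Ici (0:ℝ)) : ContinuousOn (f t) (Icc 0 1) :=
  hf.comp (f := fun x => (t, x)) (by fun_prop) fun _ hx => ⟨ht, hx⟩

namespace IsBeamSolution

variable {β γ K C t : ℝ} {a a' : ℝ → ℝ} {y yt yx yxx yxxx yxxxx ytx ytxx v vt : ℝ → ℝ → ℝ}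

lemma chain (h : IsBeamSolution β γ a y yt yx yxx yxxx yxxxx ytx ytxx) (ht : t ∈ Ici (0:ℝ)) :
    IsClampedChain (y t) (yx t) (yxx t) (yxxx t) (yxxxx t) :=
  ⟨h.dx_y t ht, h.dx_yx t ht, h.dx_yxx t ht, h.dx_yxxx t ht,
    continuousOn_slice (h.cont yxxxx (by simp)) ht, (h.clamped t ht).1, (h.clamped t ht).2⟩

lemma dt_yx (h : IsBeamSolution β γ a y yt yx yxx yxxx yxxxx ytx ytxx) :
    ∀ t ∈ Ici (0:ℝ), ∀ x ∈ Icc (0:ℝ) 1,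
      HasDerivWithinAt (fun s => yx s x) (ytx t x) (Ici 0) t :=
  fun _ ht _ hx => hasDerivWithinAt_of_mixed
    (fun t ht x hx => (h.dt_y t ht x hx).hasDerivWithinAt) h.dx_y h.dx_yt
    (h.cont ytx (by simp)) ht hx

lemma dt_yxx (h : IsBeamSolution β γ a y yt yx yxx yxxx yxxxx ytx ytxx) :
    ∀ t ∈ Ici (0:ℝ), ∀ x ∈ Icc (0:ℝ) 1,
      HasDerivWithinAt (fun s => yxx s x) (ytxx t x) (Ici 0) t :=
  fun _ ht _ hx => hasDerivWithinAt_of_mixed h.dt_yx h.dx_yx h.dx_ytx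
    (h.cont ytxx (by simp)) ht hx

lemma yt_zero (h : IsBeamSolution β γ a y yt yx yxx yxxx yxxxx ytx ytxx) (ht : t ∈ Ici (0:ℝ)) :
    yt t 0 = 0 :=
  (uniqueDiffOn_Ici 0 t ht).eq_deriv _ (h.dt_y t ht 0 (by simp)).hasDerivWithinAt
    ((hasDerivWithinAt_const t _ 0).congr (fun s hs => (h.clamped s hs).1) (h.clamped t ht).1)

lemma ytx_zero (h : IsBeamSolution β γ a y yt yx yxx yxxx yxxxx ytx ytxx) (ht : t ∈ Ici (0:ℝ)) :
    ytx t 0 = 0 :=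
  (uniqueDiffOn_Ici 0 t ht).eq_deriv _ (h.dt_yx t ht 0 (by simp))
    ((hasDerivWithinAt_const t _ 0).congr (fun s hs => (h.clamped s hs).2) (h.clamped t ht).2)

lemma cont_yt (h : IsBeamSolution β γ a y yt yx yxx yxxx yxxxx ytx ytxx) (ht : t ∈ Ici (0:ℝ)) :
    ContinuousOn (yt t) (Icc 0 1) := continuousOn_slice (h.cont yt (by simp)) ht

lemma lin_yt (h : IsBeamSolution β γ a y yt yx yxx yxxx yxxxx ytx ytxx) (T : ℝ) :
    ∃ C, ∀ t ∈ Icc 0 T, ∀ x ∈ Icc (0:ℝ) 1, |yt t x| ≤ C * x := by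
  obtain ⟨C, hC⟩ := exists_bound_of_continuousOn_prod (h.cont ytx (by simp)) T
  exact ⟨C, fun t ht x hx =>
    abs_le_mul_of_abs_deriv_le (h.dx_yt t ht.1) (h.yt_zero ht.1) (hC t ht) hx⟩

lemma isBeamMultiplier_self (h : IsBeamSolution β γ a y yt yx yxx yxxx yxxxx ytx ytxx) :
    IsBeamMultiplier y yt where
  dt t ht x hx := (h.dt_y t ht x hx).hasDerivWithinAt
  cont t ht := (h.chain ht).c₀
  cont_dt t ht := h.cont_yt ht
  lin T := by
    obtain ⟨C, hC⟩ := exists_bound_of_continuousOn_prod (h.cont yx (by simp)) T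
    exact ⟨C, fun t ht x hx =>
      abs_le_mul_of_abs_deriv_le (h.dx_y t ht.1) (h.clamped t ht.1).1 (hC t ht) hx⟩
  lin_dt := h.lin_yt

lemma isBeamMultiplier_id_mul_deriv
    (h : IsBeamSolution β γ a y yt yx yxx yxxx yxxxx ytx ytxx) :
    IsBeamMultiplier (fun t x => x * yx t x) (fun t x => x * ytx t x) where
  dt t ht x hx := (h.dt_yx t ht x hx).const_mul x
  cont t ht := continuousOn_id.mul (h.chain ht).c₁
  cont_dt t ht := continuousOn_id.mul (continuousOn_slice (h.cont ytx (by simp)) ht)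
  lin T := by
    obtain ⟨C, hC⟩ := exists_bound_of_continuousOn_prod (h.cont yx (by simp)) T
    refine ⟨C, fun t ht x hx => ?_⟩
    rw [abs_mul, abs_of_nonneg hx.1, mul_comm]
    exact mul_le_mul_of_nonneg_right (hC t ht x hx) hx.1
  lin_dt T := by
    obtain ⟨C, hC⟩ := exists_bound_of_continuousOn_prod (h.cont ytx (by simp)) T
    refine ⟨C, fun t ht x hx => ?_⟩
    rw [abs_mul, abs_of_nonneg hx.1, mul_comm]
    exact mul_le_mul_of_nonneg_right (hC t ht x hx) hx.1

lemma intervalIntegrable_mul_div (h : IsBeamSolution β γ a y yt yx yxx yxxx yxxxx ytx ytxx)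
    (hw : IsDegenerateWeight K a a') (ht : t ∈ Ici (0:ℝ)) {v : ℝ → ℝ}
    (hv : ContinuousOn v (Icc 0 1)) (hv' : ∀ x ∈ Icc (0:ℝ) 1, |v x| ≤ C * x) :
    IntervalIntegrable (fun x => yt t x * v x / a x) volume 0 1 := by
  obtain ⟨C', hC'⟩ := h.lin_yt t
  exact hw.intervalIntegrable_mul_div (h.cont_yt ht) hv (hC' t (right_mem_Icc.2 ht)) hv'

/-- The multiplier identity, with the equation used to replace `∂ₜ² y`. -/
lemma hasDerivWithinAt_pairing (h : IsBeamSolution β γ a y yt yx yxx yxxx yxxxx ytx ytxx)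
    (hw : IsDegenerateWeight K a a') (hv : IsBeamMultiplier v vt) (ht : t ∈ Ici (0:ℝ)) :
    HasDerivWithinAt (fun s => ∫ x in (0:ℝ)..1, yt s x * v s x / a x)
      (-(∫ x in (0:ℝ)..1, yxxxx t x * v t x) + ∫ x in (0:ℝ)..1, yt t x * vt t x / a x)
      (Ici 0) t := by
  obtain ⟨C, hC⟩ := h.lin_yt (t + 1)
  obtain ⟨C₄, hC₄⟩ := exists_bound_of_continuousOn_prod (h.cont yxxxx (by simp)) (t + 1)
  obtain ⟨D, hD⟩ := hv.lin (t + 1)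
  obtain ⟨D', hD'⟩ := hv.lin_dt (t + 1)
  have htI : t ∈ Icc 0 (t + 1) := ⟨ht, by linarith⟩
  have hi : IntervalIntegrable (fun x => -(yxxxx t x * v t x)) volume 0 1 :=
    intervalIntegrable_of_continuousOn_Icc ((h.chain ht).c₄.mul (hv.cont t ht)).neg
  rw [← intervalIntegral.integral_neg, ← intervalIntegral.integral_add hi
    (h.intervalIntegrable_mul_div hw ht (hv.cont_dt t ht) (hD' t htI))]
  refine hasDerivWithinAt_integral_of_bound (C := C₄ * D + C * D' * (1 / a 1))
    (f' := fun s x => -(yxxxx s x * v s x) + yt s x * vt s x / a x) ht ?_ ?_ ?_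
  · intro s hs
    obtain ⟨D, hD⟩ := hv.lin s
    exact h.intervalIntegrable_mul_div hw hs (hv.cont s hs) (hD s (right_mem_Icc.2 hs))
  · intro s hs x hx
    refine (((h.dt_yt s hs.1 x hx).hasDerivWithinAt.fun_mul
      (hv.dt s hs.1 x (Ioc_subset_Icc_self hx))).div_const (a x)).congr_deriv ?_
    have := hw.ne x hx
    field_simp
  · intro s hs x hx
    have hx' := Ioc_subset_Icc_self hx
    refine (abs_add_le _ _).trans (add_le_add ?_ (hw.abs_mul_div_le hx (hC s hs x hx')
      (hD' s hs x hx')))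
    have h4 := hC₄ s hs x hx'
    have hd := hD s hs x hx'
    have hD0 : 0 ≤ D := nonneg_of_mul_nonneg_left ((abs_nonneg _).trans hd) hx.1
    rw [abs_neg, abs_mul]
    exact mul_le_mul h4 (hd.trans (mul_le_of_le_one_right hD0 hx.2)) (abs_nonneg _)
      ((abs_nonneg _).trans h4)

lemma intervalIntegrable_kinetic (h : IsBeamSolution β γ a y yt yx yxx yxxx yxxxx ytx ytxx)
    (hw : IsDegenerateWeight K a a') (ht : t ∈ Ici (0:ℝ)) :
    IntervalIntegrable (fun x => yt t x ^ 2 / a x) volume 0 1 := by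
  obtain ⟨C, hC⟩ := h.lin_yt t
  simpa only [sq] using h.intervalIntegrable_mul_div hw ht (h.cont_yt ht)
    (hC t (right_mem_Icc.2 ht))

lemma beamEnergy_eq (h : IsBeamSolution β γ a y yt yx yxx yxxx yxxxx ytx ytxx)
    (hw : IsDegenerateWeight K a a') (ht : t ∈ Ici (0:ℝ)) :
    beamEnergy β γ a y yt yx yxx t = 1 / 2 * ((∫ x in (0:ℝ)..1, yt t x ^ 2 / a x)
      + ∫ x in (0:ℝ)..1, yxx t x ^ 2) + β / 2 * y t 1 ^ 2 + γ / 2 * yx t 1 ^ 2 := by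
  have c₂ := (h.chain ht).c₂
  rw [beamEnergy, intervalIntegral.integral_add (h.intervalIntegrable_kinetic hw ht)
    (intervalIntegrable_of_continuousOn_Icc (by fun_prop))]

/-- The energy dissipation law. -/
lemma hasDerivWithinAt_beamEnergy (h : IsBeamSolution β γ a y yt yx yxx yxxx yxxxx ytx ytxx)
    (hw : IsDegenerateWeight K a a') (ht : t ∈ Ici (0:ℝ)) :
    HasDerivWithinAt (beamEnergy β γ a y yt yx yxx) (-(yt t 1 ^ 2 + ytx t 1 ^ 2)) (Ici 0) t := by
  obtain ⟨C₁, hC₁⟩ := exists_bound_of_continuousOn_prod (h.cont yt (by simp)) (t + 1)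
  obtain ⟨C₂, hC₂⟩ := exists_bound_of_continuousOn_prod (h.cont yxxxx (by simp)) (t + 1)
  obtain ⟨C₃, hC₃⟩ := exists_bound_of_continuousOn_prod (h.cont yxx (by simp)) (t + 1)
  obtain ⟨C₄, hC₄⟩ := exists_bound_of_continuousOn_prod (h.cont ytxx (by simp)) (t + 1)
  have c₁ := h.cont_yt ht
  have c₂ := (h.chain ht).c₄
  have c₃ := (h.chain ht).c₂
  have c₄ := continuousOn_slice (h.cont ytxx (by simp)) ht
  have hint : HasDerivWithinAt (fun s => ∫ x in (0:ℝ)..1, (yt s x ^ 2 / a x + yxx s x ^ 2))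
      (∫ x in (0:ℝ)..1, (-(2 * (yt t x * yxxxx t x)) + 2 * (yxx t x * ytxx t x))) (Ici 0) t := by
    refine hasDerivWithinAt_integral_of_bound (C := 2 * (C₁ * C₂) + 2 * (C₃ * C₄))
      (f := fun s x => yt s x ^ 2 / a x + yxx s x ^ 2)
      (f' := fun s x => -(2 * (yt s x * yxxxx s x)) + 2 * (yxx s x * ytxx s x)) ht ?_ ?_ ?_
    · exact fun s hs => (h.intervalIntegrable_kinetic hw hs).add
        (intervalIntegrable_of_continuousOn_Icc ((h.chain hs).c₂.pow 2))
    · intro s hs x hx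
      refine ((((h.dt_yt s hs.1 x hx).hasDerivWithinAt.fun_pow 2).div_const (a x)).fun_add
        ((h.dt_yxx s hs.1 x (Ioc_subset_Icc_self hx)).fun_pow 2)).congr_deriv ?_
      have := hw.ne x hx
      field_simp
      push_cast
      ring
    · intro s hs x hx
      have hx' := Ioc_subset_Icc_self hx
      have b₁ := hC₁ s hs x hx'
      have b₃ := hC₃ s hs x hx'
      refine (abs_add_le _ _).trans (add_le_add ?_ ?_)
      · rw [abs_neg, abs_mul, abs_mul, abs_of_pos (two_pos : (0:ℝ) < 2)]
        exact mul_le_mul_of_nonneg_left (mul_le_mul b₁ (hC₂ s hs x hx') (abs_nonneg _)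
          ((abs_nonneg _).trans b₁)) two_pos.le
      · rw [abs_mul, abs_mul, abs_of_pos (two_pos : (0:ℝ) < 2)]
        exact mul_le_mul_of_nonneg_left (mul_le_mul b₃ (hC₄ s hs x hx') (abs_nonneg _)
          ((abs_nonneg _).trans b₃)) two_pos.le
  rw [integral_eq_sub_of_hasDerivAt_Icc
    (g := fun x => 2 * (ytx t x * yxx t x - yt t x * yxxx t x))
    (fun x hx => ((((h.dx_ytx t ht x hx).fun_mul (h.dx_yxx t ht x hx)).fun_sub
      ((h.dx_yt t ht x hx).fun_mul (h.dx_yxxx t ht x hx))).const_mul 2).congr_deriv (by ring))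
    (by fun_prop), h.yt_zero ht, h.ytx_zero ht, (h.feedback t ht).1, (h.feedback t ht).2] at hint
  have hy := ((h.dt_y t ht 1 (by simp)).hasDerivWithinAt (s := Ici 0)).fun_pow 2
  have hyx := (h.dt_yx t ht 1 (by simp)).fun_pow 2
  exact (((hint.const_mul (1 / 2)).fun_add (hy.const_mul (β / 2))).fun_add
    (hyx.const_mul (γ / 2))).congr_deriv (by push_cast; ring)

end IsBeamSolution

/-- The weighted Hardy inequality with constant `CHP`. -/
def HardyInequality (a : ℝ → ℝ) (CHP : ℝ) : Prop :=
  ∀ v v' : ℝ → ℝ, (∀ x ∈ Icc (0:ℝ) 1, HasDerivAt v (v' x) x) → ContinuousOn v' (Icc 0 1) →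
    v 0 = 0 → (∫ x in (0:ℝ)..1, (v x) ^ 2 / a x) ≤ CHP * ∫ x in (0:ℝ)..1, (v' x) ^ 2

lemma virial_boundary_le {β γ K ε ia ρ S u₀ u₁ v w : ℝ} (hβ : 0 ≤ β) (hγ : 0 ≤ γ) (hK0 : 0 < K)
    (hK2 : K < 2) (hε : 0 < ε) (hρ₁ : 2 ≤ ρ) (hρ₂ : K / 4 + 1 + ia ≤ ρ)
    (hS : S = K * β / 2 + K/4 + β + ε * β / 2 + β + 1 + 2 * γ ^ 2 + ε * γ / 2) :
    -2 * u₁ * (β * u₀ + v) + 2 * u₁ * (-(γ * u₁) - w) + (-(γ * u₁) - w) ^ 2 + ia * v ^ 2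
        + K / 2 * (u₀ * (β * u₀ + v) - u₁ * (-(γ * u₁) - w)) + (1 - K / 4) * (2 * u₁ * w)
        + ε * (β / 2 * u₀ ^ 2 + γ / 2 * u₁ ^ 2)
      ≤ ρ * (v ^ 2 + w ^ 2) + S * (u₀ ^ 2 + u₁ ^ 2) := by
  have h1 := mul_nonneg hβ (sq_nonneg (u₀ + u₁))
  have h2 := sq_nonneg (u₁ + v)
  have h3 := sq_nonneg (γ * u₁ - w)
  have h4 := mul_nonneg hK0.le (sq_nonneg (u₀ - v))
  have h5 := mul_nonneg (mul_nonneg hγ (by linarith : 0 ≤ 2 - K / 2)) (sq_nonneg u₁)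
  have h6 := mul_nonneg (sub_nonneg.2 hρ₁) (sq_nonneg w)
  have h7 := mul_nonneg (sub_nonneg.2 hρ₂) (sq_nonneg v)
  have h8 : 0 ≤ (β + 1 + 2 * γ ^ 2 + ε * γ / 2) * u₀ ^ 2 := by positivity
  have h9 : 0 ≤ (K * β / 2 + K / 4 + β + ε * β / 2) * u₁ ^ 2 := by positivity
  rw [hS]
  linear_combination h1 + h2 + h3 + h4 / 4 + h5 + h6 + h7 + h8 + h9

lemma corrector_boundary_le {β γ δ CHP κ p q r s u₀ u₁ v w I J P E : ℝ} (hδ : 0 < δ)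
    (hCHP : 0 < CHP) (hκ : κ ≤ 2) (hE : P ≤ 2 * E)
    (hcross : 2 * (r * I + s * J)
      ≤ 2 * δ * P + 1 / (2 * δ) * (CHP * (4 * r ^ 2 + 12 * r * s + 12 * s ^ 2)))
    (hv : 4 * r ^ 2 + 12 * r * s + 12 * s ^ 2 ≤ κ * (v ^ 2 + w ^ 2))
    (hu : (p + q) ^ 2 + (2 * p + 3 * q) ^ 2 ≤ 2 * κ * (u₀ ^ 2 + u₁ ^ 2))
    (h₁ : β * (p + q) - 6 * q = u₀) (h₂ : γ * (2 * p + 3 * q) + (2 * p + 6 * q) = u₁) :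
    r * I + p * -(β * u₀ + v - 2 * (-(γ * u₁) - w) + 2 * u₁)
        + (s * J + q * -(β * u₀ + v - 3 * (-(γ * u₁) - w) + 6 * u₁ - 6 * u₀))
      ≤ 2 * δ * E - (1 - 2 * δ * κ) * (u₀ ^ 2 + u₁ ^ 2) + (8 * CHP + 3) / δ * (v ^ 2 + w ^ 2) := by
  obtain ⟨j, hj⟩ : ∃ j, j = 1 / δ := ⟨_, rfl⟩
  have hj0 : 0 < j := hj ▸ one_div_pos.2 hδ
  have hδj : δ * j = 1 := by rw [hj]; field_simp
  have e₁ : 1 / (2 * δ) = j / 2 := by rw [hj]; field_simp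
  have e₂ : (8 * CHP + 3) / δ = (8 * CHP + 3) * j := by rw [hj]; ring
  rw [e₁] at hcross
  rw [e₂]
  have hvw : 0 ≤ v ^ 2 + w ^ 2 := by positivity
  have hv' := mul_le_mul_of_nonneg_left
    (hv.trans (mul_le_mul_of_nonneg_right hκ hvw)) (mul_pos hj0 hCHP).le
  have hz := mul_nonneg hj0.le (sq_nonneg (2 * δ * (p + q) + v))
  have hz' := mul_nonneg hj0.le (sq_nonneg (2 * δ * (2 * p + 3 * q) + w))
  have ez : ∀ z x : ℝ, j * (2 * δ * z + x) ^ 2 = 4 * δ * z ^ 2 + 4 * z * x + j * x ^ 2 := by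
    intro z x
    linear_combination (4 * δ * z ^ 2 + 4 * z * x) * hδj
  rw [ez] at hz hz'
  have hu' := mul_le_mul_of_nonneg_left hu hδ.le
  have hE' := mul_le_mul_of_nonneg_left hE hδ.le
  have hj₁ := mul_nonneg (mul_pos hj0 hCHP).le hvw
  have hj₂ := mul_nonneg hj0.le hvw
  linear_combination hcross / 2 + hv' / 4 + hz / 4 + hz' / 4 + hu' + hE' + 15 / 2 * hj₁
    + 11 / 4 * hj₂ - u₀ * h₁ - u₁ * h₂

namespace IsBeamSolution

variable {β γ K C t : ℝ} {a a' : ℝ → ℝ} {y yt yx yxx yxxx yxxxx ytx ytxx v vt : ℝ → ℝ → ℝ}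
  {CHP δ ε θ ρ S Cβ Cγ p q : ℝ}

lemma sq_trace_le (h : IsBeamSolution β γ a y yt yx yxx yxxx yxxxx ytx ytxx)
    (ht : t ∈ Ici (0:ℝ)) : y t 1 ^ 2 ≤ ∫ x in (0:ℝ)..1, yxx t x ^ 2 :=
  have c := h.chain ht
  (sq_le_integral_deriv_sq c.d₀ c.c₁ c.zero (right_mem_Icc.2 zero_le_one)).trans
    (integral_sq_le_integral_deriv_sq c.d₁ c.c₂ c.zero₁)

lemma sq_deriv_trace_le (h : IsBeamSolution β γ a y yt yx yxx yxxx yxxxx ytx ytxx)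
    (ht : t ∈ Ici (0:ℝ)) : yx t 1 ^ 2 ≤ ∫ x in (0:ℝ)..1, yxx t x ^ 2 :=
  have c := h.chain ht
  sq_le_integral_deriv_sq c.d₁ c.c₂ c.zero₁ (right_mem_Icc.2 zero_le_one)

lemma integral_sq_add_le_two_mul_energy
    (h : IsBeamSolution β γ a y yt yx yxx yxxx yxxxx ytx ytxx) (hw : IsDegenerateWeight K a a')
    (hβ : 0 ≤ β) (hγ : 0 ≤ γ) (ht : t ∈ Ici (0:ℝ)) :
    (∫ x in (0:ℝ)..1, yt t x ^ 2 / a x) + ∫ x in (0:ℝ)..1, yxx t x ^ 2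
      ≤ 2 * beamEnergy β γ a y yt yx yxx t := by
  rw [h.beamEnergy_eq hw ht]
  have := mul_nonneg hβ (sq_nonneg (y t 1))
  have := mul_nonneg hγ (sq_nonneg (yx t 1))
  linarith

lemma beamEnergy_nonneg (h : IsBeamSolution β γ a y yt yx yxx yxxx yxxxx ytx ytxx)
    (hw : IsDegenerateWeight K a a') (hβ : 0 ≤ β) (hγ : 0 ≤ γ) (ht : t ∈ Ici (0:ℝ)) :
    0 ≤ beamEnergy β γ a y yt yx yxx t := by
  have h1 := hw.integral_sq_div_nonneg (yt t)
  have h2 := (sq_nonneg _).trans (h.sq_trace_le ht)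
  linarith [h.integral_sq_add_le_two_mul_energy hw hβ hγ ht]

lemma beamEnergy_antitone (h : IsBeamSolution β γ a y yt yx yxx yxxx yxxxx ytx ytxx)
    (hw : IsDegenerateWeight K a a') : AntitoneOn (beamEnergy β γ a y yt yx yxx) (Ici 0) :=
  antitoneOn_of_hasDerivWithinAt_nonpos (convex_Ici 0)
    (fun _ ht => (h.hasDerivWithinAt_beamEnergy hw ht).continuousWithinAt)
    (fun _ ht => (h.hasDerivWithinAt_beamEnergy hw (interior_subset ht)).mono interior_subset)
    (fun _ _ => neg_nonpos.2 (by positivity))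

lemma sq_trace_le_energy (h : IsBeamSolution β γ a y yt yx yxx yxxx yxxxx ytx ytxx)
    (hw : IsDegenerateWeight K a a') (hβ : 0 ≤ β) (hγ : 0 ≤ γ)
    (hCβ : Cβ = if 0 < β then min 2 (2/β) else 2) (ht : t ∈ Ici (0:ℝ)) :
    y t 1 ^ 2 ≤ Cβ * beamEnergy β γ a y yt yx yxx t := by
  have hP := hw.integral_sq_div_nonneg (yt t)
  have hQ := h.sq_trace_le ht
  have h1 : y t 1 ^ 2 ≤ 2 * beamEnergy β γ a y yt yx yxx t := by
    linarith [h.integral_sq_add_le_two_mul_energy hw hβ hγ ht]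
  rw [hCβ]
  split_ifs with hβ'
  · rcases min_choice 2 (2 / β) with e | e <;> rw [e]
    · exact h1
    · rw [div_mul_eq_mul_div, le_div_iff₀ hβ', h.beamEnergy_eq hw ht]
      nlinarith [mul_nonneg hγ (sq_nonneg (yx t 1)), sq_nonneg (y t 1)]
  · exact h1

lemma sq_deriv_trace_le_energy (h : IsBeamSolution β γ a y yt yx yxx yxxx yxxxx ytx ytxx)
    (hw : IsDegenerateWeight K a a') (hβ : 0 ≤ β) (hγ : 0 ≤ γ)
    (hCγ : Cγ = if 0 < γ then min 2 (2/γ) else 2) (ht : t ∈ Ici (0:ℝ)) :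
    yx t 1 ^ 2 ≤ Cγ * beamEnergy β γ a y yt yx yxx t := by
  have hP := hw.integral_sq_div_nonneg (yt t)
  have hQ := h.sq_deriv_trace_le ht
  have h1 : yx t 1 ^ 2 ≤ 2 * beamEnergy β γ a y yt yx yxx t := by
    linarith [h.integral_sq_add_le_two_mul_energy hw hβ hγ ht]
  rw [hCγ]
  split_ifs with hγ'
  · rcases min_choice 2 (2 / γ) with e | e <;> rw [e]
    · exact h1
    · rw [div_mul_eq_mul_div, le_div_iff₀ hγ', h.beamEnergy_eq hw ht]
      nlinarith [mul_nonneg hβ (sq_nonneg (y t 1)), sq_nonneg (yx t 1)]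
  · exact h1

/-- The dissipation inequality obtained from the multipliers `x ∂ₓ y / a` and `y / a`. -/
lemma exists_hasDerivWithinAt_virial_le
    (h : IsBeamSolution β γ a y yt yx yxx yxxx yxxxx ytx ytxx) (hw : IsDegenerateWeight K a a')
    (hβ : 0 ≤ β) (hγ : 0 ≤ γ) (hK0 : 0 < K) (hε : 0 < ε) (hεK : ε ≤ 2 - K)
    (hρ₁ : 2 ≤ ρ) (hρ₂ : K / 4 + 1 + 1 / a 1 ≤ ρ)
    (hS : S = K * β / 2 + K/4 + β + ε * β / 2 + β + 1 + 2 * γ ^ 2 + ε * γ / 2)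
    (ht : t ∈ Ici (0:ℝ)) :
    ∃ d, HasDerivWithinAt (fun s => 2 * (∫ x in (0:ℝ)..1, yt s x * (x * yx s x) / a x)
        - K / 2 * (∫ x in (0:ℝ)..1, yt s x * y s x / a x) + (1 - K / 4) * yx s 1 ^ 2) d (Ici 0) t ∧
      d ≤ -ε * beamEnergy β γ a y yt yx yxx t + ρ * (yt t 1 ^ 2 + ytx t 1 ^ 2)
        + S * (y t 1 ^ 2 + yx t 1 ^ 2) := by
  refine ⟨_, (((h.hasDerivWithinAt_pairing hw h.isBeamMultiplier_id_mul_deriv ht).const_mul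
    2).fun_sub ((h.hasDerivWithinAt_pairing hw h.isBeamMultiplier_self ht).const_mul
    (K / 2))).fun_add (((h.dt_yx t ht 1 (by simp)).fun_pow 2).const_mul (1 - K / 4)), ?_⟩
  have c := h.chain ht
  obtain ⟨C, hC⟩ := exists_bound_of_continuousOn_prod (h.cont ytx (by simp)) t
  have hkin := hw.integral_mul_id_mul_deriv_div_le (h.dx_yt t ht)
    (continuousOn_slice (h.cont ytx (by simp)) ht) (h.yt_zero ht) (hC t (right_mem_Icc.2 ht))
  have hsq : ∀ x, yt t x * yt t x / a x = yt t x ^ 2 / a x := fun x => by rw [sq]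
  simp only [hsq]
  rw [c.integral_fourth_mul_id_mul_deriv, c.integral_fourth_mul_self, h.beamEnergy_eq hw ht,
    (h.feedback t ht).1, (h.feedback t ht).2]
  have hbd := virial_boundary_le (u₀ := y t 1) (u₁ := yx t 1) (v := yt t 1) (w := ytx t 1)
    hβ hγ hK0 hw.lt_two hε hρ₁ hρ₂ hS
  have hP := hw.integral_sq_div_nonneg (yt t)
  have hQ := (sq_nonneg _).trans (h.sq_trace_le ht)
  have e : yt t 1 ^ 2 / (2 * a 1) = 1 / a 1 * yt t 1 ^ 2 / 2 := by
    have := hw.one_pos.ne'; field_simp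
  rw [e] at hkin
  have hP' := mul_nonneg (by linarith : 0 ≤ (2 - K - ε) / 2) hP
  have hQ' := mul_nonneg (by linarith : 0 ≤ (2 - K - ε) / 2 + 2) hQ
  push_cast
  linear_combination 2 * hkin + hbd + hP' + hQ'

lemma abs_virial_le (h : IsBeamSolution β γ a y yt yx yxx yxxx yxxxx ytx ytxx)
    (hw : IsDegenerateWeight K a a') (hHardy : HardyInequality a CHP) (hβ : 0 ≤ β) (hγ : 0 ≤ γ)
    (hK0 : 0 < K) (hCHP : 0 < CHP) (hθ₁ : 4 / a 1 + K * CHP ≤ θ) (hθ₂ : 1 + K / 4 ≤ θ)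
    (ht : t ∈ Ici (0:ℝ)) :
    |2 * (∫ x in (0:ℝ)..1, yt t x * (x * yx t x) / a x)
        - K / 2 * (∫ x in (0:ℝ)..1, yt t x * y t x / a x)|
      ≤ 2 * θ * beamEnergy β γ a y yt yx yxx t := by
  have c := h.chain ht
  have htI : t ∈ Icc 0 t := right_mem_Icc.2 ht
  obtain ⟨C, hC⟩ := h.lin_yt t
  obtain ⟨C₀, hC₀⟩ := h.isBeamMultiplier_self.lin t
  obtain ⟨C₁, hC₁⟩ := h.isBeamMultiplier_id_mul_deriv.lin t
  have b₁ := hw.two_mul_integral_mul_div_le (h.cont_yt ht)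
    (h.isBeamMultiplier_id_mul_deriv.cont t ht) (hC t htI) (hC₁ t htI) one_pos
  have b₀ := hw.two_mul_integral_mul_div_le (h.cont_yt ht) c.c₀ (hC t htI) (hC₀ t htI) one_pos
  have hP := hw.integral_sq_div_nonneg (yt t)
  have hQ := (sq_nonneg _).trans (h.sq_trace_le ht)
  have p₁ := integral_sq_le_integral_deriv_sq c.d₁ c.c₂ c.zero₁
  have p₀ := hHardy _ _ c.d₀ c.c₁ c.zero
  have hia : 0 < 1 / a 1 := one_div_pos.2 hw.one_pos
  have hx : ∫ x in (0:ℝ)..1, (x * yx t x) ^ 2 / a x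
      ≤ 1 / a 1 * ∫ x in (0:ℝ)..1, yx t x ^ 2 := by
    have c₁ := c.c₁
    rw [← intervalIntegral.integral_const_mul]
    refine integral_mono_on_of_le_Ioo zero_le_one ?_
      (intervalIntegrable_of_continuousOn_Icc (by fun_prop)) fun x hx => ?_
    · have cm := h.isBeamMultiplier_id_mul_deriv.cont t ht
      simpa only [sq] using hw.intervalIntegrable_mul_div cm cm (hC₁ t htI) (hC₁ t htI)
    · have := mul_le_mul_of_nonneg_right (hw.sq_div_le (Ioo_subset_Ioc_self hx))
        (sq_nonneg (yx t x))
      calc (x * yx t x) ^ 2 / a x = x ^ 2 / a x * yx t x ^ 2 := by ring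
        _ ≤ _ := this
  have hE := h.integral_sq_add_le_two_mul_energy hw hβ hγ ht
  have p₁' := mul_le_mul_of_nonneg_left p₁ hia.le
  have p₀' := p₀.trans (mul_le_mul_of_nonneg_left p₁ hCHP.le)
  have h4 : 4 / a 1 = 4 * (1 / a 1) := by ring
  rw [h4] at hθ₁
  have hKC := mul_pos hK0 hCHP
  have hθP := mul_le_mul_of_nonneg_right hθ₂ hP
  have hθQ := mul_le_mul_of_nonneg_right
    (by linarith : 1 / a 1 + K / 4 * CHP ≤ θ) hQ
  have hθE := mul_le_mul_of_nonneg_left hE (by linarith : 0 ≤ θ)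
  have hK4 := mul_le_mul_of_nonneg_left b₀ (by linarith : 0 ≤ K / 4)
  have hK4' := mul_le_mul_of_nonneg_left p₀' (by linarith : 0 ≤ K / 4)
  have e : K / 2 * (∫ x in (0:ℝ)..1, yt t x * y t x / a x)
      = K / 4 * (2 * ∫ x in (0:ℝ)..1, yt t x * y t x / a x) := by ring
  rw [e]
  refine (abs_sub _ _).trans ?_
  rw [abs_mul (K / 4), abs_of_pos (by linarith : 0 < K / 4)]
  simp only [div_one, one_mul] at b₁ hK4
  linarith

lemma two_mul_cubic_pairing_le (h : IsBeamSolution β γ a y yt yx yxx yxxx yxxxx ytx ytxx)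
    (hw : IsDegenerateWeight K a a') (hHardy : HardyInequality a CHP) (hCHP : 0 < CHP)
    {η : ℝ} (hη : 0 < η) (ht : t ∈ Ici (0:ℝ)) :
    |2 * (p * (∫ x in (0:ℝ)..1, yt t x * x ^ 2 / a x)
        + q * ∫ x in (0:ℝ)..1, yt t x * x ^ 3 / a x)|
      ≤ η * (∫ x in (0:ℝ)..1, yt t x ^ 2 / a x)
        + 1 / η * (CHP * (4 * p ^ 2 + 12 * p * q + 12 * q ^ 2)) := by
  have htI : t ∈ Icc 0 t := right_mem_Icc.2 ht
  obtain ⟨C, hC⟩ := h.lin_yt t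
  obtain ⟨C₂, hC₂⟩ := (isBeamMultiplier_pow 1).lin t
  obtain ⟨C₃, hC₃⟩ := (isBeamMultiplier_pow 2).lin t
  have i₂ := h.intervalIntegrable_mul_div hw ht (v := fun x => x ^ 2) (by fun_prop) (hC₂ t htI)
  have i₃ := h.intervalIntegrable_mul_div hw ht (v := fun x => x ^ 3) (by fun_prop) (hC₃ t htI)
  have hd : ∀ x ∈ Icc (0:ℝ) 1,
      HasDerivAt (fun x => p * x ^ 2 + q * x ^ 3) (2 * p * x + 3 * q * x ^ 2) x := fun x _ =>
    ((((hasDerivAt_id' x).fun_pow 2).const_mul p).fun_add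
      (((hasDerivAt_id' x).fun_pow 3).const_mul q)).congr_deriv (by push_cast; ring)
  have hlin : ∀ x ∈ Icc (0:ℝ) 1, |p * x ^ 2 + q * x ^ 3| ≤ (|p| * C₂ + |q| * C₃) * x := by
    intro x hx
    refine (abs_add_le _ _).trans ?_
    rw [abs_mul, abs_mul]
    have h2 := mul_le_mul_of_nonneg_left (hC₂ t htI x hx) (abs_nonneg p)
    have h3 := mul_le_mul_of_nonneg_left (hC₃ t htI x hx) (abs_nonneg q)
    linarith
  have young := hw.two_mul_integral_mul_div_le (h.cont_yt ht)
    (v := fun x => p * x ^ 2 + q * x ^ 3) (by fun_prop) (hC t htI) hlin hη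
  have hsum : ∫ x in (0:ℝ)..1, yt t x * (p * x ^ 2 + q * x ^ 3) / a x
      = p * (∫ x in (0:ℝ)..1, yt t x * x ^ 2 / a x)
        + q * ∫ x in (0:ℝ)..1, yt t x * x ^ 3 / a x := by
    rw [← intervalIntegral.integral_const_mul, ← intervalIntegral.integral_const_mul,
      ← intervalIntegral.integral_add (i₂.const_mul p) (i₃.const_mul q)]
    exact integral_congr fun x _ => by ring
  rw [hsum] at young
  have hardy := hHardy _ _ hd (by fun_prop) (by simp)
  have hint : ∫ x in (0:ℝ)..1, (2 * p * x + 3 * q * x ^ 2) ^ 2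
      = 4 / 3 * p ^ 2 + 3 * p * q + 9 / 5 * q ^ 2 := by
    rw [integral_eq_sub_of_hasDerivAt_Icc (g := fun x =>
        4 / 3 * p ^ 2 * x ^ 3 + 3 * p * q * x ^ 4 + 9 / 5 * q ^ 2 * x ^ 5) (fun x _ =>
      (((((hasDerivAt_id' x).fun_pow 3).const_mul (4 / 3 * p ^ 2)).fun_add
        (((hasDerivAt_id' x).fun_pow 4).const_mul (3 * p * q))).fun_add
        (((hasDerivAt_id' x).fun_pow 5).const_mul (9 / 5 * q ^ 2))).congr_deriv
          (by push_cast; ring)) (by fun_prop)]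
    ring
  rw [hint] at hardy
  refine young.trans (add_le_add_right (mul_le_mul_of_nonneg_left (hardy.trans
    (mul_le_mul_of_nonneg_left ?_ hCHP.le)) (one_div_pos.2 hη).le) _)
  nlinarith [sq_nonneg (16 * p + 27 * q), sq_nonneg q]

/-- The pairing of `∂ₜ y` with the static solution whose boundary data are the traces of `y`
controls these traces. -/
lemma exists_hasDerivWithinAt_corrector_le
    (h : IsBeamSolution β γ a y yt yx yxx yxxx yxxxx ytx ytxx) (hw : IsDegenerateWeight K a a')
    (hHardy : HardyInequality a CHP) (hCHP : 0 < CHP) (hβ : 0 ≤ β) (hγ : 0 ≤ γ) (hδ : 0 < δ)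
    {p₁ p₂ q₁ q₂ : ℝ} (hpq : ∀ l m : ℝ,
      β * ((p₁ * l + p₂ * m) + (q₁ * l + q₂ * m)) - 6 * (q₁ * l + q₂ * m) = l ∧
      γ * (2 * (p₁ * l + p₂ * m) + 3 * (q₁ * l + q₂ * m))
        + (2 * (p₁ * l + p₂ * m) + 6 * (q₁ * l + q₂ * m)) = m)
    (ht : t ∈ Ici (0:ℝ)) :
    ∃ d, HasDerivWithinAt (fun s =>
        (p₁ * y s 1 + p₂ * yx s 1) * (∫ x in (0:ℝ)..1, yt s x * x ^ 2 / a x)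
        + (q₁ * y s 1 + q₂ * yx s 1) * ∫ x in (0:ℝ)..1, yt s x * x ^ 3 / a x) d (Ici 0) t ∧
      d ≤ 2 * δ * beamEnergy β γ a y yt yx yxx t
        - (1 - 2 * δ * (1 / max 1 β + 1 / max 1 γ)) * (y t 1 ^ 2 + yx t 1 ^ 2)
        + (8 * CHP + 3) / δ * (yt t 1 ^ 2 + ytx t 1 ^ 2) := by
  have hy := (h.dt_y t ht 1 (by simp)).hasDerivWithinAt (s := Ici 0)
  have hyx := h.dt_yx t ht 1 (by simp)
  have c := h.chain ht
  refine ⟨_, (((hy.const_mul p₁).fun_add (hyx.const_mul p₂)).fun_mul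
    (h.hasDerivWithinAt_pairing hw (isBeamMultiplier_pow 1) ht)).fun_add
    (((hy.const_mul q₁).fun_add (hyx.const_mul q₂)).fun_mul
    (h.hasDerivWithinAt_pairing hw (isBeamMultiplier_pow 2) ht)), ?_⟩
  simp only [Nat.reduceAdd, mul_zero, zero_div, intervalIntegral.integral_zero, add_zero]
  rw [c.integral_fourth_mul_sq, c.integral_fourth_mul_cube, (h.feedback t ht).1,
    (h.feedback t ht).2]
  have cross := (le_abs_self _).trans (h.two_mul_cubic_pairing_le hw hHardy hCHP
    (p := p₁ * yt t 1 + p₂ * ytx t 1) (q := q₁ * yt t 1 + q₂ * ytx t 1)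
    (η := 2 * δ) (by linarith) ht)
  have sv := (static_energy_le hβ hγ (hpq (yt t 1) (ytx t 1)).1 (hpq (yt t 1) (ytx t 1)).2).1
  have su := (static_energy_le hβ hγ (hpq (y t 1) (yx t 1)).1 (hpq (y t 1) (yx t 1)).2).2
  obtain ⟨e₁, e₂⟩ := hpq (y t 1) (yx t 1)
  have hE := h.integral_sq_add_le_two_mul_energy hw hβ hγ ht
  have hP := hw.integral_sq_div_nonneg (yt t)
  have hQ := (sq_nonneg _).trans (h.sq_trace_le ht)
  have h1β : 1 / max 1 β ≤ 1 := (div_le_one (lt_max_of_lt_left one_pos)).2 (le_max_left _ _)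
  have h1γ : 1 / max 1 γ ≤ 1 := (div_le_one (lt_max_of_lt_left one_pos)).2 (le_max_left _ _)
  exact corrector_boundary_le hδ hCHP (by linarith : 1 / max 1 β + 1 / max 1 γ ≤ 2) (by linarith)
    cross sv su e₁ e₂

lemma abs_corrector_le
    (h : IsBeamSolution β γ a y yt yx yxx yxxx yxxxx ytx ytxx) (hw : IsDegenerateWeight K a a')
    (hHardy : HardyInequality a CHP) (hCHP : 0 < CHP) (hβ : 0 ≤ β) (hγ : 0 ≤ γ)
    (hCβ : Cβ = if 0 < β then min 2 (2/β) else 2) (hCγ : Cγ = if 0 < γ then min 2 (2/γ) else 2)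
    {p₁ p₂ q₁ q₂ : ℝ} (hpq : ∀ l m : ℝ,
      β * ((p₁ * l + p₂ * m) + (q₁ * l + q₂ * m)) - 6 * (q₁ * l + q₂ * m) = l ∧
      γ * (2 * (p₁ * l + p₂ * m) + 3 * (q₁ * l + q₂ * m))
        + (2 * (p₁ * l + p₂ * m) + 6 * (q₁ * l + q₂ * m)) = m)
    (ht : t ∈ Ici (0:ℝ)) :
    |(p₁ * y t 1 + p₂ * yx t 1) * (∫ x in (0:ℝ)..1, yt t x * x ^ 2 / a x)
        + (q₁ * y t 1 + q₂ * yx t 1) * ∫ x in (0:ℝ)..1, yt t x * x ^ 3 / a x|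
      ≤ (1 + CHP * (Cβ + Cγ)) * beamEnergy β γ a y yt yx yxx t := by
  have cross := h.two_mul_cubic_pairing_le hw hHardy hCHP
    (p := p₁ * y t 1 + p₂ * yx t 1) (q := q₁ * y t 1 + q₂ * yx t 1) one_pos ht
  have su := (static_energy_le hβ hγ (hpq (y t 1) (yx t 1)).1 (hpq (y t 1) (yx t 1)).2).1
  have hE := h.integral_sq_add_le_two_mul_energy hw hβ hγ ht
  have hQ := (sq_nonneg _).trans (h.sq_trace_le ht)
  have h₀ := h.sq_trace_le_energy hw hβ hγ hCβ ht
  have h₁ := h.sq_deriv_trace_le_energy hw hβ hγ hCγ ht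
  have h1β : 1 / max 1 β ≤ 1 := (div_le_one (lt_max_of_lt_left one_pos)).2 (le_max_left _ _)
  have h1γ : 1 / max 1 γ ≤ 1 := (div_le_one (lt_max_of_lt_left one_pos)).2 (le_max_left _ _)
  have su' := su.trans (mul_le_mul_of_nonneg_right (add_le_add h1β h1γ) (by positivity))
  have su'' := mul_le_mul_of_nonneg_left su' hCHP.le
  have hsum := mul_le_mul_of_nonneg_left (add_le_add h₀ h₁) hCHP.le
  rw [abs_mul, abs_of_pos (two_pos : (0:ℝ) < 2)] at cross
  simp only [div_one, one_mul] at cross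
  linarith

end IsBeamSolution

end

/-- Theorem 3.8: uniform exponential decay of the energy for the degenerate beam
problem, `E(t) ≤ E(0) e^{1 − t/M}`. -/
theorem stmt17
    (β γ K : ℝ) (a a' : ℝ → ℝ)
    (y yt ytt yx yxx yxxx yxxxx ytx ytxx : ℝ → ℝ → ℝ) (E : ℝ → ℝ)
    (hβ : 0 ≤ β) (hγ : 0 ≤ γ)
    -- degeneracy context
    (ha_cont : ContinuousOn a (Set.Icc 0 1))
    (ha0 : a 0 = 0)
    (ha_pos : ∀ x ∈ Set.Ioc (0:ℝ) 1, 0 < a x)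
    (ha_deriv : ∀ x ∈ Set.Ioc (0:ℝ) 1, HasDerivAt a (a' x) x)
    (ha'_cont : ContinuousOn a' (Set.Ioc 0 1))
    (hK0 : 0 < K) (hK2 : K < 2)
    (hKbound : ∀ x ∈ Set.Ioc (0:ℝ) 1, x * |a' x| ≤ K * a x)
    -- smoothness: all the relevant partial derivatives exist ...
    (hyt : ∀ t ∈ Set.Ici (0:ℝ), ∀ x ∈ Set.Icc (0:ℝ) 1,
      HasDerivAt (fun s => y s x) (yt t x) t)
    (hytt : ∀ t ∈ Set.Ici (0:ℝ), ∀ x ∈ Set.Icc (0:ℝ) 1,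
      HasDerivAt (fun s => yt s x) (ytt t x) t)
    (hyx : ∀ t ∈ Set.Ici (0:ℝ), ∀ x ∈ Set.Icc (0:ℝ) 1,
      HasDerivAt (fun ξ => y t ξ) (yx t x) x)
    (hyxx : ∀ t ∈ Set.Ici (0:ℝ), ∀ x ∈ Set.Icc (0:ℝ) 1,
      HasDerivAt (fun ξ => yx t ξ) (yxx t x) x)
    (hyxxx : ∀ t ∈ Set.Ici (0:ℝ), ∀ x ∈ Set.Icc (0:ℝ) 1,
      HasDerivAt (fun ξ => yxx t ξ) (yxxx t x) x)
    (hyxxxx : ∀ t ∈ Set.Ici (0:ℝ), ∀ x ∈ Set.Icc (0:ℝ) 1,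
      HasDerivAt (fun ξ => yxxx t ξ) (yxxxx t x) x)
    (hytx : ∀ t ∈ Set.Ici (0:ℝ), ∀ x ∈ Set.Icc (0:ℝ) 1,
      HasDerivAt (fun ξ => yt t ξ) (ytx t x) x)
    (hytxx : ∀ t ∈ Set.Ici (0:ℝ), ∀ x ∈ Set.Icc (0:ℝ) 1,
      HasDerivAt (fun ξ => ytx t ξ) (ytxx t x) x)
    -- ... and are continuous on the space-time domain
    (hcont : ∀ f ∈ [y, yt, ytt, yx, yxx, yxxx, yxxxx, ytx, ytxx],
      ContinuousOn (fun p : ℝ × ℝ => f p.1 p.2) (Set.Ici (0:ℝ) ×ˢ Set.Icc 0 1))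
    -- the degenerate beam equation
    (heq : ∀ t ∈ Set.Ici (0:ℝ), ∀ x ∈ Set.Ioc (0:ℝ) 1,
      ytt t x + a x * yxxxx t x = 0)
    -- clamped conditions at 0, dissipative conditions at 1
    (hbc0 : ∀ t ∈ Set.Ici (0:ℝ), y t 0 = 0 ∧ yx t 0 = 0)
    (hbc1 : ∀ t ∈ Set.Ici (0:ℝ),
      β * y t 1 - yxxx t 1 + yt t 1 = 0 ∧ γ * yx t 1 + yxx t 1 + ytx t 1 = 0)
    -- weighted Hardy inequality with constant C_HP
    (CHP : ℝ) (hCHP : 0 < CHP)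
    (hHardy : ∀ v v' : ℝ → ℝ,
      (∀ x ∈ Set.Icc (0:ℝ) 1, HasDerivAt v (v' x) x) →
      ContinuousOn v' (Set.Icc 0 1) → v 0 = 0 →
      (∫ x in (0:ℝ)..1, (v x) ^ 2 / a x) ≤ CHP * ∫ x in (0:ℝ)..1, (v' x) ^ 2)
    (hE : ∀ t, E t = (1/2) * (∫ x in (0:ℝ)..1, ((yt t x) ^ 2 / a x + (yxx t x) ^ 2))
        + (β/2) * (y t 1) ^ 2 + (γ/2) * (yx t 1) ^ 2)
    -- the constants of Theorem 3.8
    (θ ρ Cβ Cγ ν : ℝ)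
    (hθ : θ = max (4 / a 1 + K * CHP) (1 + K/4))
    (hρ : ρ = max 2 (K/4 + 1 + 1 / a 1))
    (hCβ : Cβ = if 0 < β then min 2 (2/β) else 2)
    (hCγ : Cγ = if 0 < γ then min 2 (2/γ) else 2)
    (hν : ν = if 1 < β then
        (if 1 < γ then β * γ / (2 * (β + γ)) else β / (2 * (β + 1)))
      else
        (if 1 < γ then γ / (2 * (1 + γ)) else 1/4))
    (δ Cδ : ℝ) (hδ0 : 0 < δ) (hδν : δ < ν)
    (hCδ : Cδ = if 1 < β then
        (if 1 < γ then 1 - 2 * δ * (1/β + 1/γ) else 1 - 2 * δ * (1/β + 1))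
      else
        (if 1 < γ then 1 - 2 * δ * (1 + 1/γ) else 1 - 4 * δ))
    (ε₀ : ℝ) (hε₀ : 0 < ε₀) (hε₀K : ε₀ ≤ 2 - K)
    (S C₁ C₂ C₃ M : ℝ)
    (hS : S = K * β / 2 + K/4 + β + ε₀ * β / 2 + β + 1 + 2 * γ ^ 2 + ε₀ * γ / 2)
    (hC₁ : C₁ = (2 / Cδ) * S)
    (hC₃ : C₃ = (1 / Cδ)
        * (2 + 2 * (4 * CHP + 1) * (Cβ + Cγ) + (1/δ) * (8 * CHP + 3)) * S)
    (hC₂ : C₂ = 4 * θ + ρ + (Cγ/2) * (2 - K/2) + C₃)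
    (hδC₁ : δ * C₁ < ε₀)
    (hM : M = C₂ / (ε₀ - δ * C₁)) :
    ∀ t : ℝ, 0 < t → E t ≤ E 0 * Real.exp (1 - t / M) := by
  obtain rfl : E = beamEnergy β γ a y yt yx yxx := funext hE
  have hw : IsDegenerateWeight K a a' := ⟨ha_pos, ha_deriv, ha'_cont, hK2, hKbound⟩
  have h : IsBeamSolution β γ a y yt yx yxx yxxx yxxxx ytx ytxx :=
    { dt_y := hyt
      dt_yt := fun t ht x hx =>
        (hytt t ht x ⟨hx.1.le, hx.2⟩).congr_deriv (eq_neg_of_add_eq_zero_left (heq t ht x hx))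
      dx_y := hyx
      dx_yx := hyxx
      dx_yxx := hyxxx
      dx_yxxx := hyxxxx
      dx_yt := hytx
      dx_ytx := hytxx
      cont := fun f hf => hcont f (by simp only [List.mem_cons] at hf ⊢; tauto)
      clamped := hbc0
      feedback := fun t ht => ⟨by linarith [(hbc1 t ht).1], by linarith [(hbc1 t ht).2]⟩ }
  obtain ⟨κ, hκ⟩ : ∃ κ, κ = 1 / max 1 β + 1 / max 1 γ := ⟨_, rfl⟩
  have hκ0 : 0 < κ := hκ ▸ add_pos (one_div_pos.2 (lt_max_of_lt_left one_pos))
    (one_div_pos.2 (lt_max_of_lt_left one_pos))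
  have hCδκ : Cδ = 1 - 2 * δ * κ := by
    rw [hCδ, hκ]
    split_ifs with h1 h2 h2
    · rw [max_eq_right h1.le, max_eq_right h2.le]
    · rw [max_eq_right h1.le, max_eq_left (not_lt.1 h2), div_one 1]
    · rw [max_eq_left (not_lt.1 h1), max_eq_right h2.le, div_one 1]
    · rw [max_eq_left (not_lt.1 h1), max_eq_left (not_lt.1 h2)]; ring
  have hνκ : ν * (2 * κ) = 1 := by
    rw [hν, hκ]
    split_ifs with h1 h2 h2
    · rw [max_eq_right h1.le, max_eq_right h2.le]; field_simp; ring
    · rw [max_eq_right h1.le, max_eq_left (not_lt.1 h2)]; field_simp; ring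
    · rw [max_eq_left (not_lt.1 h1), max_eq_right h2.le]; field_simp; ring
    · rw [max_eq_left (not_lt.1 h1), max_eq_left (not_lt.1 h2)]; norm_num
  have hCδ0 : 0 < Cδ := by
    have := mul_lt_mul_of_pos_right hδν (by linarith : 0 < 2 * κ)
    rw [hCδκ]
    linarith
  have hS0 : 0 ≤ S := by rw [hS]; positivity
  have hCβ0 : 0 ≤ Cβ := by rw [hCβ]; split_ifs <;> positivity
  have hCγ0 : 0 ≤ Cγ := by rw [hCγ]; split_ifs <;> positivity
  have hθ₁ : 4 / a 1 + K * CHP ≤ θ := hθ ▸ le_max_left _ _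
  have hθ₂ : 1 + K / 4 ≤ θ := hθ ▸ le_max_right _ _
  have hρ₁ : 2 ≤ ρ := hρ ▸ le_max_left _ _
  have hρ₂ : K / 4 + 1 + 1 / a 1 ≤ ρ := hρ ▸ le_max_right _ _
  obtain ⟨A, hA⟩ : ∃ A, A = S / Cδ := ⟨_, rfl⟩
  have hA0 : 0 ≤ A := hA ▸ div_nonneg hS0 hCδ0.le
  have hAS : A * Cδ = S := hA ▸ div_mul_cancel₀ S hCδ0.ne'
  obtain ⟨B, hB⟩ : ∃ B, B = (8 * CHP + 3) / δ := ⟨_, rfl⟩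
  have hB0 : 0 ≤ B := hB ▸ by positivity
  have hC₁A : C₁ = 2 * A := by rw [hC₁, hA]; ring
  have hC₃A : C₃ = A * (2 + 2 * (4 * CHP + 1) * (Cβ + Cγ) + B) := by rw [hC₃, hA, hB]; ring
  have hC₂0 : 0 < C₂ := by
    have : 0 ≤ C₃ := by rw [hC₃A]; positivity
    have := mul_nonneg (by linarith : 0 ≤ Cγ / 2) (by linarith : 0 ≤ 2 - K / 2)
    rw [hC₂]
    linarith
  obtain ⟨p₁, p₂, q₁, q₂, hpq⟩ := exists_static_coeff hβ hγ
  choose! Φ' hΦ hΦ' using fun t (ht : t ∈ Set.Ici (0:ℝ)) =>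
    h.exists_hasDerivWithinAt_virial_le hw hβ hγ hK0 hε₀ hε₀K hρ₁ hρ₂ hS ht
  choose! Ψ' hΨ hΨ' using fun t (ht : t ∈ Set.Ici (0:ℝ)) =>
    h.exists_hasDerivWithinAt_corrector_le hw hHardy hCHP hβ hγ hδ0 hpq ht
  intro t ht
  rw [hM]
  refine exp_decay_of_dissipation (sub_pos.2 hδC₁) hC₂0
    (fun t ht => h.beamEnergy_nonneg hw hβ hγ ht) (h.beamEnergy_antitone hw)
    (fun t ht => ((hΦ t ht).fun_add ((h.hasDerivWithinAt_beamEnergy hw ht).const_mul ρ)).fun_add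
      (((hΨ t ht).fun_add ((h.hasDerivWithinAt_beamEnergy hw ht).const_mul B)).const_mul A))
    (fun t ht => ?_) (fun s t hs hst => ?_) ht.le
  · have h1 := hΦ' t ht
    have h2 := mul_le_mul_of_nonneg_left (hΨ' t ht) hA0
    rw [← hκ, ← hCδκ, ← hB] at h2
    rw [hC₁A]
    linear_combination h1 + h2 - (y t 1 ^ 2 + yx t 1 ^ 2) * hAS
  · have ht := hs.trans hst
    have hEst := h.beamEnergy_antitone hw hs ht hst
    have hEt := h.beamEnergy_nonneg hw hβ hγ ht
    have hEs := hEt.trans hEst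
    have w₁ := (abs_le.1 (h.abs_virial_le hw hHardy hβ hγ hK0 hCHP hθ₁ hθ₂ hs)).2
    have w₂ := (abs_le.1 (h.abs_virial_le hw hHardy hβ hγ hK0 hCHP hθ₁ hθ₂ ht)).1
    have c₁ := mul_le_mul_of_nonneg_left
      (abs_le.1 (h.abs_corrector_le hw hHardy hCHP hβ hγ hCβ hCγ hpq hs)).2 hA0
    have c₂ := mul_le_mul_of_nonneg_left
      (abs_le.1 (h.abs_corrector_le hw hHardy hCHP hβ hγ hCβ hCγ hpq ht)).1 hA0
    have b₁ := mul_le_mul_of_nonneg_left (h.sq_deriv_trace_le_energy hw hβ hγ hCγ hs)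
      (by linarith : 0 ≤ 1 - K / 4)
    have b₂ := mul_nonneg (by linarith : 0 ≤ 1 - K / 4) (sq_nonneg (yx t 1))
    have n₁ := mul_le_mul_of_nonneg_left hEst (by linarith : 0 ≤ 2 * θ)
    have n₂ := mul_le_mul_of_nonneg_left hEst
      (by positivity : 0 ≤ A * (1 + CHP * (Cβ + Cγ)))
    have n₃ := mul_nonneg (by linarith : 0 ≤ ρ) hEt
    have n₄ := mul_nonneg (mul_nonneg hA0 hB0) hEt
    have n₅ : 0 ≤ A * ((6 * CHP + 2) * (Cβ + Cγ)) * beamEnergy β γ a y yt yx yxx s := by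
      positivity
    rw [hC₂, hC₃A]
    linear_combination w₁ + w₂ + c₁ + c₂ + b₁ + b₂ + n₁ + n₂ + n₃ + n₄ + n₅
end
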